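/- arXiv:1104.3793 — 2 statements merged into one kernel-verified Lean document; each statement's English description precedes it below -/
import Mathlib

section
/- Let U and V be weak quantum vertex algebras and let R(x) be an invertible twisting operator for (U,V). Then the twisted tensor product U⊗_R V is a weak quantum vertex algebra. -/
open scoped TensorProduct BigOperators

noncomputable section

/-- Integer binomial coefficient `C(n, k)` for `n : ℤ`, `k : ℕ`. -/
def zchoose (n : ℤ) (k : ℕ) : ℤ :=
  if 0 ≤ n then ((n.toNat).choose k : ℤ)
  else (-1) ^ k * ((((k : ℤ) - n - 1).toNat).choose k)

section Series

variable {V : Type*} [AddCommGroup V] [Module ℂ V]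

/-- `a` is (the coefficient family of) an element of `V((x))`. -/
def IsLaurent (a : ℤ → V) : Prop := ∃ N : ℤ, ∀ n : ℤ, n < N → a n = 0

/-- `a` is an element of `V[[x]]`. -/
def IsPowerSeries (a : ℤ → V) : Prop := ∀ n : ℤ, n < 0 → a n = 0

/-- `A` is an element of `V((x₁, x₂))` (first index: exponent of `x₁`). -/
def IsLaurent2 (A : ℤ → ℤ → V) : Prop :=
  ∃ N : ℤ, ∀ m n : ℤ, (m < N ∨ n < N) → A m n = 0

/-- `a` is an element of `V ⊗ ℂ((x)) ⊆ V((x))`: truncated below, with coefficients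
lying in a finitely generated (i.e. finite dimensional) subspace. -/
def IsTensorLaurent (a : ℤ → V) : Prop :=
  IsLaurent a ∧ ∃ F : Submodule ℂ V, F.FG ∧ ∀ n, a n ∈ F

/-- Multiply the double series `A(x₁,x₂)` by `(x₁+x₂)^k`. -/
def mulAddPow (k : ℕ) (A : ℤ → ℤ → V) : ℤ → ℤ → V := fun a b =>
  ∑ j ∈ Finset.range (k + 1), ((k.choose j : ℕ) : ℂ) • A (a - (k : ℤ) + j) (b - j)

/-- Multiply the double series `A(x₁,x₂)` by `(x₁-x₂)^k`. -/
def mulSubPow (k : ℕ) (A : ℤ → ℤ → V) : ℤ → ℤ → V := fun a b =>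
  ∑ j ∈ Finset.range (k + 1),
    ((-1 : ℂ) ^ j * ((k.choose j : ℕ) : ℂ)) • A (a - (k : ℤ) + j) (b - j)

/-- Multiply the double series `A(x₁,x₂)` by `(x₂-x₁)^k`. -/
def mulSubPow' (k : ℕ) (A : ℤ → ℤ → V) : ℤ → ℤ → V := fun a b =>
  ∑ j ∈ Finset.range (k + 1),
    ((-1 : ℂ) ^ j * ((k.choose j : ℕ) : ℂ)) • A (a - j) (b - (k : ℤ) + j)

/-- Substitute `x₁ = x₀ + x₂` in `A(x₁,x₂)`, expanding in nonnegative powers of `x₂`.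
The result is indexed by (exponent of `x₀`, exponent of `x₂`). -/
def substAdd02 (A : ℤ → ℤ → V) : ℤ → ℤ → V := fun a b =>
  ∑ᶠ i : ℕ, ((zchoose (a + i) i : ℤ) : ℂ) • A (a + i) (b - i)

/-- Substitute `x₁ = x₂ + x₀` in `A(x₁,x₂)`, expanding in nonnegative powers of `x₀`.
The result is indexed by (exponent of `x₀`, exponent of `x₂`). -/
def substAdd20 (A : ℤ → ℤ → V) : ℤ → ℤ → V := fun a b =>
  if 0 ≤ a then ∑ᶠ m : ℤ, ((zchoose m a.toNat : ℤ) : ℂ) • A m (b - m + a) else 0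

/-- Multiply the double series `A(x₁,x₂)` by `f(x₂ - x₁)`, expanded in nonnegative
powers of `x₁`. -/
def scalarMulSub (f : ℤ → ℂ) (A : ℤ → ℤ → V) : ℤ → ℤ → V := fun m n =>
  ∑ᶠ (i : ℕ) (p : ℤ),
    ((-1 : ℂ) ^ i * ((zchoose p i : ℤ) : ℂ) * f p) • A (m - i) (n - p + i)

/-- Multiply a double series by a polynomial in two variables. -/
def polyMul2 (p : MvPolynomial (Fin 2) ℂ) (A : ℤ → ℤ → V) : ℤ → ℤ → V := fun m n =>
  ∑ d ∈ p.support, MvPolynomial.coeff d p • A (m - (d 0 : ℤ)) (n - (d 1 : ℤ))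

/-- The relation `A ∼ B`: `p·A = p·B` for some nonzero polynomial `p(x₁,x₂)`. -/
def SimEq2 (A B : ℤ → ℤ → V) : Prop :=
  ∃ p : MvPolynomial (Fin 2) ℂ, p ≠ 0 ∧ ∀ m n : ℤ, polyMul2 p A m n = polyMul2 p B m n

/-- `a` is an element of the iterated Laurent series space `V((x₁))⋯((x_n))`. -/
def IsIterLaurent : (n : ℕ) → ((Fin n → ℤ) → V) → Prop
  | 0, _ => True
  | n + 1, a =>
      (∃ N : ℤ, ∀ k : Fin (n + 1) → ℤ, k (Fin.last n) < N → a k = 0) ∧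
      ∀ m : ℤ, IsIterLaurent n fun k => a (Fin.snoc k m)

end Series

/-- A nonlocal vertex algebra over `ℂ`, with `Y u v n` the coefficient of `x^n`
in `Y(u,x)v` (so `u_m v = Y u v (-m-1)`). -/
structure NLVA (V : Type*) [AddCommGroup V] [Module ℂ V] where
  Y : V →ₗ[ℂ] V →ₗ[ℂ] (ℤ → V)
  one : V
  trunc : ∀ u v : V, IsLaurent (Y u v)
  vacuum_left : ∀ (v : V) (n : ℤ), Y one v n = if n = 0 then v else 0
  creation_reg : ∀ v : V, IsPowerSeries (Y v one)
  creation_zero : ∀ v : V, Y v one 0 = v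
  weak_assoc : ∀ u v w : V, ∃ k : ℕ, ∀ a b : ℤ,
    mulAddPow k (substAdd02 fun m n => Y u (Y v w n) m) a b
      = mulAddPow k (fun a' b' => Y (Y u v a') w b') a b

namespace NLVA

variable {U V K : Type*} [AddCommGroup U] [Module ℂ U] [AddCommGroup V] [Module ℂ V]
  [AddCommGroup K] [Module ℂ K]

/-- The coefficient `Y(·)_n(·)` as a bilinear map. -/
def Yc (𝒱 : NLVA V) (n : ℤ) : V →ₗ[ℂ] V →ₗ[ℂ] V :=
  𝒱.Y.compr₂ (LinearMap.proj n)

/-- The operator `D(v) = v_{-2}𝟙`, i.e. the coefficient of `x^1` in `Y(v,x)𝟙`. -/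
def D (𝒱 : NLVA V) : V →ₗ[ℂ] V :=
  (LinearMap.proj (1 : ℤ)).comp (𝒱.Y.flip 𝒱.one)

/-- Homomorphisms of nonlocal vertex algebras. -/
def IsHom (𝒰 : NLVA U) (𝒱 : NLVA V) (f : U →ₗ[ℂ] V) : Prop :=
  f 𝒰.one = 𝒱.one ∧ ∀ (a b : U) (n : ℤ), f (𝒰.Y a b n) = 𝒱.Y (f a) (f b) n

/-- `𝒦` is generated, as a nonlocal vertex algebra, by the subset `S`. -/
def IsGeneratedBy (𝒦 : NLVA K) (S : Set K) : Prop :=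
  ∀ P : Submodule ℂ K, 𝒦.one ∈ P →
    (∀ a ∈ P, ∀ b ∈ P, ∀ n : ℤ, 𝒦.Y a b n ∈ P) → S ⊆ P → P = ⊤

/-- `𝒰` is irreducible as a module over itself. -/
def SelfIrreducible (𝒰 : NLVA U) : Prop :=
  Nontrivial U ∧
    ∀ P : Submodule ℂ U, (∀ u : U, ∀ p ∈ P, ∀ n : ℤ, 𝒰.Y u p n ∈ P) → P = ⊥ ∨ P = ⊤

/-- The coefficients of the product `Y(v₁,x₁)⋯Y(v_n,x_n)𝟙`. -/
def prodY (𝒱 : NLVA V) : (n : ℕ) → (Fin n → V) → (Fin n → ℤ) → V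
  | 0, _, _ => 𝒱.one
  | n + 1, v, k => 𝒱.Y (v 0) (prodY 𝒱 n (fun i => v i.succ) fun i => k i.succ) (k 0)

/-- Non-degeneracy in the sense of Etingof–Kazhdan: the maps
`Z_n : V^{⊗n} ⊗ ℂ((x₁))⋯((x_n)) → V((x₁))⋯((x_n))` are injective. -/
def NonDegenerate (𝒱 : NLVA V) : Prop :=
  ∀ n : ℕ, 0 < n → ∀ (r : ℕ) (v : Fin r → Fin n → V) (f : Fin r → (Fin n → ℤ) → ℂ),
    (∀ j, IsIterLaurent n (f j)) →
    LinearIndependent ℂ (fun j : Fin r => PiTensorProduct.tprod ℂ (v j)) →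
    (∀ K' : Fin n → ℤ,
      (∑ j : Fin r, ∑ᶠ L : Fin n → ℤ,
        f j L • 𝒱.prodY n (v j) fun i => K' i - L i) = 0) →
    ∀ j, f j = 0

end NLVA

/-- Countable dimension over `ℂ`. -/
def CountableDim (U : Type*) [AddCommGroup U] [Module ℂ U] : Prop :=
  ∃ s : Set U, s.Countable ∧ Submodule.span ℂ s = ⊤

/-- `𝒱` satisfies `𝒮`-locality, i.e. is a weak quantum vertex algebra. -/
def SLocal {V : Type*} [AddCommGroup V] [Module ℂ V] (𝒱 : NLVA V) : Prop :=
  ∀ u v : V, ∃ (r : ℕ) (uu vv : Fin r → V) (f : Fin r → ℤ → ℂ) (k : ℕ),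
    (∀ i, IsLaurent (f i)) ∧ ∀ (w : V) (m n : ℤ),
      mulSubPow k (fun a b => 𝒱.Y u (𝒱.Y v w b) a) m n
        = mulSubPow k (fun a b => ∑ i, scalarMulSub (f i)
            (fun a' b' => 𝒱.Y (vv i) (𝒱.Y (uu i) w a') b') a b) m n

/-- A module for a nonlocal vertex algebra. -/
structure NLVAModule {V : Type*} [AddCommGroup V] [Module ℂ V] (𝒱 : NLVA V)
    (W : Type*) [AddCommGroup W] [Module ℂ W] where
  Yw : V →ₗ[ℂ] W →ₗ[ℂ] (ℤ → W)
  trunc : ∀ (v : V) (w : W), IsLaurent (Yw v w)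
  vacuum : ∀ (w : W) (n : ℤ), Yw 𝒱.one w n = if n = 0 then w else 0
  weak_assoc : ∀ (u v : V) (w : W), ∃ k : ℕ, ∀ a b : ℤ,
    mulAddPow k (substAdd02 fun m n => Yw u (Yw v w n) m) a b
      = mulAddPow k (fun a' b' => Yw (𝒱.Y u v a') w b') a b

section Twist

variable {U V : Type*} [AddCommGroup U] [Module ℂ U] [AddCommGroup V] [Module ℂ V]

/-- Coefficient of `x₁^m x₂^n` in `(Y(x₂)⊗1)R²³(x₁)R¹²(x₁+x₂)` applied to `v ⊗ u ⊗ u'`. -/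
def hex1RHS (𝒰 : NLVA U) (Rc : ℤ → (V ⊗[ℂ] U →ₗ[ℂ] U ⊗[ℂ] V))
    (v : V) (u u' : U) (m n : ℤ) : U ⊗[ℂ] V :=
  ∑ᶠ (i : ℕ) (c : ℤ),
    ((zchoose (m - c + i) i : ℤ) : ℂ) •
      (TensorProduct.map (TensorProduct.lift (𝒰.Yc (n - i))) LinearMap.id)
        ((TensorProduct.assoc ℂ U U V).symm
          ((LinearMap.lTensor U (Rc c))
            ((TensorProduct.assoc ℂ U V U)
              ((Rc (m - c + i) (v ⊗ₜ u)) ⊗ₜ u'))))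

/-- Coefficient of `x₁^m x₂^n` in `(1⊗Y(x₂))R¹²(x₁-x₂)R²³(x₁)` applied to `v ⊗ v' ⊗ u`. -/
def hex2RHS (𝒱 : NLVA V) (Rc : ℤ → (V ⊗[ℂ] U →ₗ[ℂ] U ⊗[ℂ] V))
    (v v' : V) (u : U) (m n : ℤ) : U ⊗[ℂ] V :=
  ∑ᶠ (i : ℕ) (c : ℤ),
    ((-1 : ℂ) ^ i * ((zchoose (m - c + i) i : ℤ) : ℂ)) •
      (LinearMap.lTensor U (TensorProduct.lift (𝒱.Yc (n - i))))
        ((TensorProduct.assoc ℂ U V V)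
          ((TensorProduct.map (Rc (m - c + i)) LinearMap.id)
            ((TensorProduct.assoc ℂ V U V).symm
              (v ⊗ₜ (Rc c (v' ⊗ₜ u))))))

/-- A twisting operator `R(x) : V ⊗ U → U ⊗ V ⊗ ℂ((x))` for the ordered pair `(U,V)`,
given by its family of coefficients `Rc n`. -/
structure TwistingOp (𝒰 : NLVA U) (𝒱 : NLVA V) where
  Rc : ℤ → (V ⊗[ℂ] U →ₗ[ℂ] U ⊗[ℂ] V)
  laurent : ∀ t : V ⊗[ℂ] U, IsTensorLaurent fun n => Rc n t
  vac_right : ∀ (v : V) (n : ℤ),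
    Rc n (v ⊗ₜ 𝒰.one) = if n = 0 then 𝒰.one ⊗ₜ v else 0
  vac_left : ∀ (u : U) (n : ℤ),
    Rc n (𝒱.one ⊗ₜ u) = if n = 0 then u ⊗ₜ 𝒱.one else 0
  hex1 : ∀ (v : V) (u u' : U) (m n : ℤ),
    Rc m (v ⊗ₜ (𝒰.Y u u' n)) = hex1RHS 𝒰 Rc v u u' m n
  hex2 : ∀ (v v' : V) (u : U) (m n : ℤ),
    Rc m ((𝒱.Y v v' n) ⊗ₜ u) = hex2RHS 𝒱 Rc v v' u m n

/-- `Sc` is a two-sided inverse of `Rc` as `ℂ((x))`-linear maps (coefficientwise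
convolution), with values in the tensor with `ℂ((x))`. -/
def IsInvPair {A B : Type*} [AddCommGroup A] [Module ℂ A] [AddCommGroup B] [Module ℂ B]
    (Rc : ℤ → (A →ₗ[ℂ] B)) (Sc : ℤ → (B →ₗ[ℂ] A)) : Prop :=
  (∀ t : B, IsTensorLaurent fun n => Sc n t) ∧
  (∀ (t : A) (n : ℤ), (∑ᶠ c : ℤ, Sc c (Rc (n - c) t)) = if n = 0 then t else 0) ∧
  (∀ (t : B) (n : ℤ), (∑ᶠ c : ℤ, Rc c (Sc (n - c) t)) = if n = 0 then t else 0)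

/-- The canonical embedding `u ↦ u ⊗ 𝟙`. -/
def iotaU (𝒱 : NLVA V) : U →ₗ[ℂ] U ⊗[ℂ] V := (TensorProduct.mk ℂ U V).flip 𝒱.one

/-- The canonical embedding `v ↦ 𝟙 ⊗ v`. -/
def iotaV (𝒰 : NLVA U) : V →ₗ[ℂ] U ⊗[ℂ] V := TensorProduct.mk ℂ U V 𝒰.one

/-- The operator `D ⊗ 1 + 1 ⊗ D` on `U ⊗ V`. -/
def DUV (𝒰 : NLVA U) (𝒱 : NLVA V) : U ⊗[ℂ] V →ₗ[ℂ] U ⊗[ℂ] V :=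
  LinearMap.rTensor V 𝒰.D + LinearMap.lTensor U 𝒱.D

/-- The coefficient of `x^n` in `Y_R(u⊗v, x)(u'⊗v') = (Y(x)⊗Y(x))R²³(-x)(u⊗v⊗u'⊗v')`. -/
def YRcoef (𝒰 : NLVA U) (𝒱 : NLVA V) (Rop : TwistingOp 𝒰 𝒱)
    (u : U) (v : V) (u' : U) (v' : V) (n : ℤ) : U ⊗[ℂ] V :=
  ∑ᶠ (c : ℤ) (a : ℤ),
    ((-1 : ℂ) ^ c) •
      (TensorProduct.map (𝒰.Yc a u) ((𝒱.Yc (n - c - a)).flip v'))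
        (Rop.Rc c (v ⊗ₜ u'))

/-- `𝒯` is the twisted tensor product nonlocal vertex algebra `U ⊗_R V`. -/
def IsTwistedTensor (𝒰 : NLVA U) (𝒱 : NLVA V) (Rop : TwistingOp 𝒰 𝒱)
    (𝒯 : NLVA (U ⊗[ℂ] V)) : Prop :=
  𝒯.one = 𝒰.one ⊗ₜ 𝒱.one ∧
  ∀ (u u' : U) (v v' : V) (n : ℤ),
    𝒯.Y (u ⊗ₜ v) (u' ⊗ₜ v') n = YRcoef 𝒰 𝒱 Rop u v u' v' n

end Twist

section Aux

variable {A B W T : Type*} [AddCommGroup A] [Module ℂ A] [AddCommGroup B] [Module ℂ B]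
  [AddCommGroup W] [Module ℂ W] [AddCommGroup T] [Module ℂ T]

/-- The linear map `(a ⊗ b) ↦ Y_A(a)_e (Y_B(b)_j w)`, i.e. the coefficient
of `Y_A(x₂)(1 ⊗ Y_B(x₁)) (· ⊗ · ⊗ w)` at `x₂^e x₁^j`. -/
def sandwichMod (YA : A →ₗ[ℂ] W →ₗ[ℂ] (ℤ → W)) (YB : B →ₗ[ℂ] W →ₗ[ℂ] (ℤ → W))
    (w : W) (e j : ℤ) : A ⊗[ℂ] B →ₗ[ℂ] W :=
  TensorProduct.lift
    ((YA.compr₂ (LinearMap.proj e)).compl₂ ((YB.compr₂ (LinearMap.proj j)).flip w))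

/-- Coefficient of `x₁^m x₂^n` in `Y_A(x₂)(1 ⊗ Y_B(x₁)) q(x₂ - x₁) (⋯ ⊗ w)`, where the
series `q` is evaluated at `x₂ - x₁`, expanded in nonnegative powers of `x₁`. -/
def twistRHS (YA : A →ₗ[ℂ] W →ₗ[ℂ] (ℤ → W)) (YB : B →ₗ[ℂ] W →ₗ[ℂ] (ℤ → W))
    (q : ℤ → A ⊗[ℂ] B) (w : W) : ℤ → ℤ → W := fun m n =>
  ∑ᶠ (i : ℕ) (p : ℤ),
    ((-1 : ℂ) ^ i * ((zchoose p i : ℤ) : ℂ)) •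
      sandwichMod YA YB w (n - p + i) (m - i) (q p)

/-- As `twistRHS`, but with `q` evaluated at `-x₂ + x₁`, expanded in nonnegative
powers of `x₂`. -/
def twistRHSalt (YA : A →ₗ[ℂ] W →ₗ[ℂ] (ℤ → W)) (YB : B →ₗ[ℂ] W →ₗ[ℂ] (ℤ → W))
    (q : ℤ → A ⊗[ℂ] B) (w : W) : ℤ → ℤ → W := fun m n =>
  ∑ᶠ (i : ℕ) (p : ℤ),
    ((-1 : ℂ) ^ i * ((zchoose p i : ℤ) : ℂ)) •
      sandwichMod YA YB w (n - i) (m - p + i) (q p)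

/-- Coefficient of `x^n` in `e^{xD} F(x)` where `F` is given by its coefficients. -/
def expD (Dop : T →ₗ[ℂ] T) (F : ℤ → T) (n : ℤ) : T :=
  ∑ᶠ j : ℕ, ((j.factorial : ℂ))⁻¹ • (Dop ^ j) (F (n - j))

end Aux

section YBE

variable {V : Type*} [AddCommGroup V] [Module ℂ V]

/-- The flip of the last two tensor factors of `(V⊗V)⊗V`. -/
def swap23 : (V ⊗[ℂ] V) ⊗[ℂ] V →ₗ[ℂ] (V ⊗[ℂ] V) ⊗[ℂ] V :=
  ((TensorProduct.assoc ℂ V V V).symm.toLinearMap).comp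
    ((LinearMap.lTensor V (TensorProduct.comm ℂ V V).toLinearMap).comp
      (TensorProduct.assoc ℂ V V V).toLinearMap)

/-- `S¹²` acting on `(V⊗V)⊗V`. -/
def S12m (Sc : ℤ → (V ⊗[ℂ] V →ₗ[ℂ] V ⊗[ℂ] V)) (c : ℤ) :
    (V ⊗[ℂ] V) ⊗[ℂ] V →ₗ[ℂ] (V ⊗[ℂ] V) ⊗[ℂ] V :=
  TensorProduct.map (Sc c) LinearMap.id

/-- `S²³` acting on `(V⊗V)⊗V`. -/
def S23m (Sc : ℤ → (V ⊗[ℂ] V →ₗ[ℂ] V ⊗[ℂ] V)) (c : ℤ) :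
    (V ⊗[ℂ] V) ⊗[ℂ] V →ₗ[ℂ] (V ⊗[ℂ] V) ⊗[ℂ] V :=
  ((TensorProduct.assoc ℂ V V V).symm.toLinearMap).comp
    ((LinearMap.lTensor V (Sc c)).comp (TensorProduct.assoc ℂ V V V).toLinearMap)

/-- `S¹³` acting on `(V⊗V)⊗V`. -/
def S13m (Sc : ℤ → (V ⊗[ℂ] V →ₗ[ℂ] V ⊗[ℂ] V)) (c : ℤ) :
    (V ⊗[ℂ] V) ⊗[ℂ] V →ₗ[ℂ] (V ⊗[ℂ] V) ⊗[ℂ] V :=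
  swap23.comp ((S12m Sc c).comp swap23)

/-- `S²¹(x) = σ S(x) σ`. -/
def S21c (Sc : ℤ → (V ⊗[ℂ] V →ₗ[ℂ] V ⊗[ℂ] V)) (c : ℤ) :
    V ⊗[ℂ] V →ₗ[ℂ] V ⊗[ℂ] V :=
  ((TensorProduct.comm ℂ V V).toLinearMap).comp
    ((Sc c).comp (TensorProduct.comm ℂ V V).toLinearMap)

/-- The quantum Yang–Baxter equation
`S¹²(x)S¹³(x+z)S²³(z) = S²³(z)S¹³(x+z)S¹²(x)` (coefficient of `x^a z^b`, with
`S¹³(x+z)` expanded in nonnegative powers of `z`). -/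
def QYBE (Sc : ℤ → (V ⊗[ℂ] V →ₗ[ℂ] V ⊗[ℂ] V)) : Prop :=
  ∀ (t : (V ⊗[ℂ] V) ⊗[ℂ] V) (a b : ℤ),
    (∑ᶠ (i : ℕ) (p : ℤ), ((zchoose p i : ℤ) : ℂ) •
        S12m Sc (a - p + i) (S13m Sc p (S23m Sc (b - i) t)))
      = ∑ᶠ (i : ℕ) (p : ℤ), ((zchoose p i : ℤ) : ℂ) •
          S23m Sc (b - i) (S13m Sc p (S12m Sc (a - p + i) t))

/-- Unitarity: `S(x) S²¹(-x) = 1`. -/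
def Unitary (Sc : ℤ → (V ⊗[ℂ] V →ₗ[ℂ] V ⊗[ℂ] V)) : Prop :=
  ∀ (t : V ⊗[ℂ] V) (n : ℤ),
    (∑ᶠ c : ℤ, ((-1 : ℂ) ^ (n - c)) • Sc c (S21c Sc (n - c) t))
      = if n = 0 then t else 0

/-- `[D ⊗ 1, S(x)] = -(d/dx) S(x)`. -/
def DComm1 (𝒱 : NLVA V) (Sc : ℤ → (V ⊗[ℂ] V →ₗ[ℂ] V ⊗[ℂ] V)) : Prop :=
  ∀ (t : V ⊗[ℂ] V) (n : ℤ),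
    (LinearMap.rTensor V 𝒱.D) (Sc n t) - Sc n ((LinearMap.rTensor V 𝒱.D) t)
      = (-((n : ℂ) + 1)) • Sc (n + 1) t

/-- `Y(u,x)v = e^{xD} Y(-x) S(-x)(v⊗u)`. -/
def SkewS (𝒱 : NLVA V) (Sc : ℤ → (V ⊗[ℂ] V →ₗ[ℂ] V ⊗[ℂ] V)) : Prop :=
  ∀ (u v : V) (n : ℤ),
    𝒱.Y u v n = expD 𝒱.D (fun p => ((-1 : ℂ) ^ p) •
      ∑ᶠ c : ℤ, (TensorProduct.lift (𝒱.Yc (p - c))) (Sc c (v ⊗ₜ u))) n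

/-- `S(x₁)(Y(x₂)⊗1) = (Y(x₂)⊗1)S²³(x₁)S¹³(x₁+x₂)`. -/
def HexY1 (𝒱 : NLVA V) (Sc : ℤ → (V ⊗[ℂ] V →ₗ[ℂ] V ⊗[ℂ] V)) : Prop :=
  ∀ (t : (V ⊗[ℂ] V) ⊗[ℂ] V) (m n : ℤ),
    Sc m ((TensorProduct.map (TensorProduct.lift (𝒱.Yc n)) LinearMap.id) t)
      = ∑ᶠ (i : ℕ) (p : ℤ), ((zchoose p i : ℤ) : ℂ) •
          (TensorProduct.map (TensorProduct.lift (𝒱.Yc (n - i))) LinearMap.id)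
            (S23m Sc (m - p + i) (S13m Sc p t))

/-- `S(x₁)(1⊗Y(x₂)) = (1⊗Y(x₂))S¹²(x₁-x₂)S¹³(x₁)`. -/
def HexY2 (𝒱 : NLVA V) (Sc : ℤ → (V ⊗[ℂ] V →ₗ[ℂ] V ⊗[ℂ] V)) : Prop :=
  ∀ (t : (V ⊗[ℂ] V) ⊗[ℂ] V) (m n : ℤ),
    Sc m ((LinearMap.lTensor V (TensorProduct.lift (𝒱.Yc n)))
        ((TensorProduct.assoc ℂ V V V) t))
      = ∑ᶠ (i : ℕ) (p : ℤ), ((-1 : ℂ) ^ i * ((zchoose p i : ℤ) : ℂ)) •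
          (LinearMap.lTensor V (TensorProduct.lift (𝒱.Yc (n - i))))
            ((TensorProduct.assoc ℂ V V V)
              (S12m Sc p (S13m Sc (m - p + i) t)))

/-- A quantum vertex algebra `(V, 𝒮)`. -/
structure QVA (V : Type*) [AddCommGroup V] [Module ℂ V] where
  alg : NLVA V
  sloc : SLocal alg
  Sc : ℤ → (V ⊗[ℂ] V →ₗ[ℂ] V ⊗[ℂ] V)
  laurent : ∀ t : V ⊗[ℂ] V, IsTensorLaurent fun n => Sc n t
  qybe : QYBE Sc
  unitary : Unitary Sc
  vac : ∀ (v : V) (n : ℤ), Sc n (alg.one ⊗ₜ v) = if n = 0 then alg.one ⊗ₜ v else 0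
  dcomm : DComm1 alg Sc
  skew : SkewS alg Sc
  hex : HexY1 alg Sc

end YBE

section Bialg

variable {H : Type*} [AddCommGroup H] [Module ℂ H]

/-- A nonlocal vertex bialgebra. -/
structure NLVBialg (H : Type*) [AddCommGroup H] [Module ℂ H] where
  alg : NLVA H
  comul : H →ₗ[ℂ] H ⊗[ℂ] H
  counit : H →ₗ[ℂ] ℂ
  coassoc : ∀ h : H, (LinearMap.lTensor H comul) (comul h)
      = (TensorProduct.assoc ℂ H H H) ((LinearMap.rTensor H comul) (comul h))
  counit_comul_left : ∀ h : H,
      (TensorProduct.lid ℂ H) ((LinearMap.rTensor H counit) (comul h)) = h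
  counit_comul_right : ∀ h : H,
      (TensorProduct.rid ℂ H) ((LinearMap.lTensor H counit) (comul h)) = h
  counit_one : counit alg.one = 1
  counit_mul : ∀ (a b : H) (n : ℤ),
      counit (alg.Y a b n) = if n = 0 then counit a * counit b else 0
  comul_one : comul alg.one = alg.one ⊗ₜ alg.one
  comul_mul : ∀ (a b : H) (n : ℤ),
      comul (alg.Y a b n)
        = ∑ᶠ p : ℤ, (TensorProduct.map₂ (alg.Yc p) (alg.Yc (n - p))) (comul a) (comul b)

/-- A nonlocal vertex `H`-module-algebra. -/
structure NLVModAlg (𝓗 : NLVBialg H) (U : Type*) [AddCommGroup U] [Module ℂ U] where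
  alg : NLVA U
  act : NLVAModule 𝓗.alg U
  scalar : ∀ (h : H) (u : U), IsTensorLaurent fun n => act.Yw h u n
  vac : ∀ (h : H) (n : ℤ),
      act.Yw h alg.one n = if n = 0 then 𝓗.counit h • alg.one else 0
  compat : ∀ (h : H) (u v : U) (m n : ℤ),
      act.Yw h (alg.Y u v n) m
        = ∑ᶠ (i : ℕ) (p : ℤ), ((-1 : ℂ) ^ i * ((zchoose p i : ℤ) : ℂ)) •
            (TensorProduct.lift
              (((alg.Yc (n - i)).comp ((act.Yw.compr₂ (LinearMap.proj p)).flip u)).compl₂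
                ((act.Yw.compr₂ (LinearMap.proj (m - p + i))).flip v)))
            (𝓗.comul h)

/-- A nonlocal vertex `H`-comodule-algebra. -/
structure NLVComodAlg (𝓗 : NLVBialg H) (V : Type*) [AddCommGroup V] [Module ℂ V] where
  alg : NLVA V
  rho : V →ₗ[ℂ] H ⊗[ℂ] V
  coassoc : ∀ v : V, (LinearMap.lTensor H rho) (rho v)
      = (TensorProduct.assoc ℂ H H V) ((LinearMap.rTensor V 𝓗.comul) (rho v))
  counit_rho : ∀ v : V,
      (TensorProduct.lid ℂ V) ((LinearMap.rTensor V 𝓗.counit) (rho v)) = v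
  rho_one : rho alg.one = 𝓗.alg.one ⊗ₜ alg.one
  rho_mul : ∀ (v v' : V) (n : ℤ),
      rho (alg.Y v v' n)
        = ∑ᶠ p : ℤ, (TensorProduct.map₂ (𝓗.alg.Yc p) (alg.Yc (n - p))) (rho v) (rho v')

/-- The coefficient of `x^n` in
`Y_♯(u⊗v, x)(u'⊗v') = Y(u,x)Y(b¹(v),x)u' ⊗ Y(v²,x)v'`. -/
def Ysharp (𝓗 : NLVBialg H) {U V : Type*} [AddCommGroup U] [Module ℂ U]
    [AddCommGroup V] [Module ℂ V] (MU : NLVModAlg 𝓗 U) (CV : NLVComodAlg 𝓗 V)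
    (u : U) (v : V) (u' : U) (v' : V) (n : ℤ) : U ⊗[ℂ] V :=
  ∑ᶠ (a : ℤ) (p : ℤ),
    (TensorProduct.map
      ((MU.alg.Yc a u).comp ((MU.act.Yw.compr₂ (LinearMap.proj p)).flip u'))
      ((CV.alg.Yc (n - a - p)).flip v'))
    (CV.rho v)

/-- Rearrangement `(H⊗V)⊗U → (H⊗U)⊗V`. -/
def smashSwap {U V : Type*} [AddCommGroup U] [Module ℂ U]
    [AddCommGroup V] [Module ℂ V] :
    (H ⊗[ℂ] V) ⊗[ℂ] U →ₗ[ℂ] (H ⊗[ℂ] U) ⊗[ℂ] V :=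
  ((TensorProduct.assoc ℂ H U V).symm.toLinearMap).comp
    ((LinearMap.lTensor H (TensorProduct.comm ℂ V U).toLinearMap).comp
      (TensorProduct.assoc ℂ H V U).toLinearMap)

/-- The coefficient of `x^n` in `R(x)(v⊗u) = Y(b¹(v),-x)u ⊗ v²`. -/
def Rsmash (𝓗 : NLVBialg H) {U V : Type*} [AddCommGroup U] [Module ℂ U]
    [AddCommGroup V] [Module ℂ V] (MU : NLVModAlg 𝓗 U) (CV : NLVComodAlg 𝓗 V)
    (n : ℤ) : V ⊗[ℂ] U →ₗ[ℂ] U ⊗[ℂ] V :=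
  ((-1 : ℂ) ^ n) •
    ((TensorProduct.map
        (TensorProduct.lift (MU.act.Yw.compr₂ (LinearMap.proj n))) LinearMap.id).comp
      (smashSwap.comp (LinearMap.rTensor U CV.rho)))

end Bialg

/-! ### Integer binomial coefficients -/

theorem zchoose_zero_right (n : ℤ) : zchoose n 0 = 1 := by
  unfold zchoose; split_ifs <;> simp

theorem zchoose_zero_succ (k : ℕ) : zchoose 0 (k + 1) = 0 := by
  simp [zchoose]

theorem zchoose_natCast (n k : ℕ) : zchoose (n : ℤ) k = n.choose k := by
  simp [zchoose]

theorem zchoose_negSucc (n k : ℕ) :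
    zchoose (-(n : ℤ) - 1) k = (-1) ^ k * ((n + k).choose k : ℤ) := by
  unfold zchoose
  rw [if_neg (by omega)]
  congr 3
  omega

theorem zchoose_succ_succ (n : ℤ) (k : ℕ) :
    zchoose (n + 1) (k + 1) = zchoose n k + zchoose n (k + 1) := by
  rcases le_or_gt 0 n with h | h
  · lift n to ℕ using h
    have : (n : ℤ) + 1 = ((n + 1 : ℕ) : ℤ) := by push_cast; ring
    rw [this, zchoose_natCast, zchoose_natCast, zchoose_natCast, Nat.choose_succ_succ]
    push_cast; ring
  · obtain ⟨m, rfl⟩ : ∃ m : ℕ, n = -(m : ℤ) - 1 := ⟨(-n - 1).toNat, by omega⟩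
    rw [zchoose_negSucc, zchoose_negSucc]
    rcases m with _ | m
    · simp [zchoose_zero_succ, pow_succ]
    · have : -((m + 1 : ℕ) : ℤ) - 1 + 1 = -(m : ℤ) - 1 := by push_cast; ring
      rw [this, zchoose_negSucc]
      have e : (m + 1 + (k + 1)).choose (k + 1)
          = (m + 1 + k).choose k + (m + (k + 1)).choose (k + 1) := by
        rw [show m + 1 + (k + 1) = (m + 1 + k) + 1 by ring, Nat.choose_succ_succ,
          show m + (k + 1) = m + 1 + k by ring]
      rw [e]
      push_cast; ring

theorem zchoose_reflect (a : ℤ) (i : ℕ) :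
    zchoose (-a - 1 + i) i = (-1) ^ i * zchoose a i := by
  rcases lt_or_ge a 0 with h | h
  · obtain ⟨m, rfl⟩ : ∃ m : ℕ, a = -(m : ℤ) - 1 := ⟨(-a - 1).toNat, by omega⟩
    rw [zchoose_negSucc, show -(-(m : ℤ) - 1) - 1 + i = ((m + i : ℕ) : ℤ) by push_cast; ring,
      zchoose_natCast, ← mul_assoc, ← mul_pow]
    simp
  · lift a to ℕ using h
    rw [zchoose_natCast]
    rcases lt_or_ge a i with h | h
    · rw [show -(a : ℤ) - 1 + i = ((i - a - 1 : ℕ) : ℤ) by omega, zchoose_natCast,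
        Nat.choose_eq_zero_of_lt h, Nat.choose_eq_zero_of_lt (by omega)]
      simp
    · rw [show -(a : ℤ) - 1 + i = -((a - i : ℕ) : ℤ) - 1 by omega, zchoose_negSucc,
        Nat.sub_add_cancel h]

/-! ### Finite sums -/

section Finsum

variable {M : Type*} [AddCommGroup M]

theorem finsum_swap {α β : Type*} (F : α → β → M) (s : Set α) (t : Set β)
    (hs : s.Finite) (ht : t.Finite) (h : ∀ a b, F a b ≠ 0 → a ∈ s ∧ b ∈ t) :
    (∑ᶠ a, ∑ᶠ b, F a b) = ∑ᶠ b, ∑ᶠ a, F a b := by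
  have h1 : ∀ a, (∑ᶠ b, F a b) = ∑ b ∈ ht.toFinset, F a b := fun a =>
    finsum_eq_sum_of_support_subset _ fun b hb => by
      simpa using (h a b hb).2
  have h2 : ∀ b, (∑ᶠ a, F a b) = ∑ a ∈ hs.toFinset, F a b := fun b =>
    finsum_eq_sum_of_support_subset _ fun a ha => by
      simpa using (h a b ha).1
  simp only [h1, h2]
  rw [finsum_eq_sum_of_support_subset (s := hs.toFinset),
    finsum_eq_sum_of_support_subset (s := ht.toFinset), Finset.sum_comm]
  · intro b hb
    obtain ⟨a, -, ha⟩ := Finset.exists_ne_zero_of_sum_ne_zero hb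
    simpa using (h a b ha).2
  · intro a ha
    obtain ⟨b, -, hb⟩ := Finset.exists_ne_zero_of_sum_ne_zero ha
    simpa using (h a b hb).1

theorem finsum_int_shift (F : ℤ → M) (c : ℤ) : (∑ᶠ p, F (p + c)) = ∑ᶠ p, F p :=
  finsum_comp_equiv (Equiv.addRight c)

theorem finsum_int_eq_nat (F : ℤ → M) (h : ∀ p < 0, F p = 0) :
    (∑ᶠ p, F p) = ∑ᶠ i : ℕ, F i := by
  rw [← finsum_mem_range (g := fun i : ℕ => (i : ℤ)) Nat.cast_injective, finsum_mem_def]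
  refine finsum_congr fun p => ?_
  rcases lt_or_ge p 0 with hp | hp
  · rw [h p hp, Set.indicator_apply_eq_zero.2 fun _ => h p hp]
  · exact (Set.indicator_of_mem (Set.mem_range.2 ⟨p.toNat, Int.toNat_of_nonneg hp⟩) F).symm

theorem finsum_nat_eq_range (F : ℕ → M) (K : ℕ) (h : ∀ i, K ≤ i → F i = 0) :
    (∑ᶠ i, F i) = ∑ i ∈ Finset.range K, F i :=
  finsum_eq_sum_of_support_subset _ fun i hi => by
    by_contra hc
    exact hi (h i (by simpa using hc))

end Finsum

/-! ### The three term relation -/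

section Three

variable {W : Type*} [AddCommGroup W]

/-- The relation satisfied by the pairing of a field with `x₁^a x₂^b x₀^c`, which
expresses `x₁ = x₂ + x₀`. -/
def Three (P : ℤ → ℤ → ℤ → W) : Prop :=
  ∀ a b c, P (a + 1) b c = P a (b + 1) c + P a b (c + 1)

namespace Three

variable {P Q : ℤ → ℤ → ℤ → W}

theorem sub (hP : Three P) (hQ : Three Q) : Three fun a b c => P a b c - Q a b c := by
  intro a b c
  simp only [hP a b c, hQ a b c]; abel

theorem add (hP : Three P) (hQ : Three Q) : Three fun a b c => P a b c + Q a b c := by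
  intro a b c
  simp only [hP a b c, hQ a b c]; abel

theorem sum {ι : Type*} {s : Finset ι} {P : ι → ℤ → ℤ → ℤ → W} (h : ∀ i ∈ s, Three (P i)) :
    Three fun a b c => ∑ i ∈ s, P i a b c := by
  intro a b c
  simp only [← Finset.sum_add_distrib]
  exact Finset.sum_congr rfl fun i hi => h i hi a b c

theorem swap (hP : Three P) : Three fun a b c => P a c b := by
  intro a b c
  simp only [hP a c b]; abel

theorem reflect [Module ℂ W] (hP : Three P) : Three fun a b c => (-1 : ℂ) ^ b • P c b a := by
  intro a b c
  simp only [hP c b a, zpow_add₀ (show (-1 : ℂ) ≠ 0 by norm_num), zpow_one, smul_add, mul_neg,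
    mul_one, neg_smul]
  abel

theorem reflect' [Module ℂ W] (hP : Three P) : Three fun a b c => (-1 : ℂ) ^ c • P b a c := by
  intro a b c
  simp only [hP b a c, zpow_add₀ (show (-1 : ℂ) ≠ 0 by norm_num), zpow_one, smul_add, mul_neg,
    mul_one, neg_smul]
  abel

theorem iterate [Module ℂ W] (hP : Three P) (k : ℕ) : ∀ a b c,
    P (a + k) b c =
      ∑ j ∈ Finset.range (k + 1), ((k.choose j : ℕ) : ℂ) • P a (b + j) (c + k - j) := by
  induction k with
  | zero => intro a b c; simp
  | succ k ih =>
    intro a b c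
    have e : P (a + (k + 1 : ℕ)) b c = P (a + k) (b + 1) c + P (a + k) b (c + 1) := by
      rw [← hP]; push_cast; ring_nf
    rw [e, ih, ih, Finset.sum_range_succ' _ (k + 1)]
    simp only [Nat.choose_succ_succ, Nat.cast_add, add_smul, Finset.sum_add_distrib]
    rw [add_assoc (Finset.sum _ _)]
    congr 1
    · refine Finset.sum_congr rfl fun j _ => ?_
      congr 2 <;> push_cast <;> ring
    · rw [Finset.sum_range_succ' _ k, Finset.sum_range_succ _ k]
      simp only [Nat.choose_succ_self, Nat.cast_zero, zero_smul, add_zero, Nat.choose_zero_right]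
      congr 1
      · refine Finset.sum_congr rfl fun j _ => ?_
        congr 2; push_cast; ring
      · congr 2; push_cast; ring

theorem iterate' [Module ℂ W] (hP : Three P) (k : ℕ) (a b c : ℤ) :
    P a b (c + k) = ∑ j ∈ Finset.range (k + 1),
      ((-1 : ℂ) ^ j * ((k.choose j : ℕ) : ℂ)) • P (a + k - j) (b + j) c := by
  have h := hP.reflect.iterate k c b a
  simp only [zpow_add₀ (show (-1 : ℂ) ≠ 0 by norm_num), zpow_natCast] at h
  have h' := congrArg (fun w => (-1 : ℂ) ^ b • w) h
  simp only [smul_smul, Finset.smul_sum, ← mul_zpow] at h'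
  simp only [mul_neg, mul_one, neg_neg, one_zpow, one_smul] at h'
  rw [h']
  refine Finset.sum_congr rfl fun j _ => ?_
  congr 1
  have : (-1 : ℂ) ^ b * (-1 : ℂ) ^ b = 1 := by rw [← mul_zpow]; norm_num
  linear_combination ((k.choose j : ℕ) : ℂ) * (-1 : ℂ) ^ j * this

theorem vanish_ab_of_le (hP : Three P) (a₀ a₁ b₀ : ℤ) (h1 : ∀ a b c, a₀ ≤ a → P a b c = 0)
    (h2 : ∀ a b c, a₁ ≤ a → b₀ ≤ b → P a b c = 0) (a b c : ℤ) (ha : a₁ ≤ a) : P a b c = 0 := by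
  have key : ∀ s : ℕ, ∀ a b c, a₁ ≤ a → a₀ + b₀ - s ≤ a + b → P a b c = 0 := by
    intro s
    induction s with
    | zero =>
      intro a b c ha hs
      rcases le_or_gt a₀ a with h | h
      · exact h1 a b c h
      · exact h2 a b c ha (by push_cast at hs; omega)
    | succ s ih =>
      intro a b c ha hs
      have e := hP a b (c - 1)
      rw [ih (a + 1) b _ (by omega) (by push_cast at hs; omega),
        ih a (b + 1) _ ha (by push_cast at hs; omega), sub_add_cancel, zero_add] at e
      exact e.symm
  exact key (a₀ + b₀ - (a + b)).toNat a b c ha (by omega)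

theorem vanish_ab (hP : Three P) (a₀ b₀ : ℤ) (h1 : ∀ a b c, a₀ ≤ a → P a b c = 0)
    (h2 : ∀ a b c, b₀ ≤ b → P a b c = 0) (a b c : ℤ) : P a b c = 0 :=
  hP.vanish_ab_of_le a₀ a b₀ h1 (fun a b c _ => h2 a b c) a b c le_rfl

theorem vanish_ac (hP : Three P) (a₀ c₀ : ℤ) (h1 : ∀ a b c, a₀ ≤ a → P a b c = 0)
    (h2 : ∀ a b c, c₀ ≤ c → P a b c = 0) (a b c : ℤ) : P a b c = 0 :=
  hP.swap.vanish_ab a₀ c₀ (fun a b c => h1 a c b) (fun a b c => h2 a c b) a c b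

theorem vanish_bc [Module ℂ W] (hP : Three P) (b₀ c₀ : ℤ) (h1 : ∀ a b c, b₀ ≤ b → P a b c = 0)
    (h2 : ∀ a b c, c₀ ≤ c → P a b c = 0) (a b c : ℤ) : P a b c = 0 := by
  have h := hP.reflect.vanish_ab c₀ b₀ (fun a b c h => by simp [h2 c b a h])
    (fun a b c h => by simp [h1 c b a h]) c b a
  exact (smul_eq_zero_iff_right (zpow_ne_zero _ (by norm_num))).1 h

theorem vanish_of_le_a (hP : Three P) (a₀ : ℤ) (h : ∀ b c, P a₀ b c = 0) (a b c : ℤ)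
    (ha : a₀ ≤ a) : P a b c = 0 := by
  induction a, ha using Int.leInduction generalizing b c with
  | base => exact h b c
  | succ a _ ih => rw [hP, ih, ih, add_zero]

theorem vanish_of_le_c (hP : Three P) (c₀ : ℤ) (h : ∀ a b, P a b c₀ = 0) (a b c : ℤ)
    (hc : c₀ ≤ c) : P a b c = 0 := by
  induction c, hc using Int.leInduction generalizing a b with
  | base => exact h a b
  | succ c _ ih =>
    have e := hP a b c
    rw [ih, ih, zero_add] at e
    exact e.symm

end Three

end Three

/-! ### Pairings of double series with `x₁^a x₂^b x₀^c` -/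

section Pairing

variable {W : Type*} [AddCommGroup W] [Module ℂ W]

theorem neg_one_zpow_mul_self (n : ℤ) : (-1 : ℂ) ^ n * (-1 : ℂ) ^ n = 1 := by
  rw [← mul_zpow]; norm_num

theorem neg_one_zpow_smul_smul (n : ℤ) (w : W) : (-1 : ℂ) ^ n • (-1 : ℂ) ^ n • w = w := by
  rw [smul_smul, neg_one_zpow_mul_self, one_smul]

/-- The sum of `F` against the binomial expansion of `(y + z)^a y^c z^b` in nonnegative
powers of `z`. -/
def binomPairing (F : ℤ → ℤ → W) (a b c : ℤ) : W :=
  ∑ᶠ i : ℕ, ((zchoose a i : ℤ) : ℂ) • F (b + i) (a + c - i)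

theorem binomPairing_eq_range {F : ℤ → ℤ → W} {N : ℤ} (hF : ∀ m n, N ≤ m → F m n = 0)
    (a b c : ℤ) (K : ℕ) (hK : N - b ≤ K) :
    binomPairing F a b c = ∑ i ∈ Finset.range K, ((zchoose a i : ℤ) : ℂ) • F (b + i) (a + c - i) :=
  finsum_nat_eq_range _ K fun i hi => by rw [hF _ _ (by omega), smul_zero]

theorem three_binomPairing {F : ℤ → ℤ → W} {N : ℤ} (hF : ∀ m n, N ≤ m → F m n = 0) :
    Three (binomPairing F) := by
  intro a b c
  rw [binomPairing_eq_range hF (a + 1) b c ((N - b).toNat + 1) (by omega),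
    binomPairing_eq_range hF a (b + 1) c (N - b).toNat (by omega),
    binomPairing_eq_range hF a b (c + 1) ((N - b).toNat + 1) (by omega),
    Finset.sum_range_succ' _ (N - b).toNat, Finset.sum_range_succ' _ (N - b).toNat]
  simp only [zchoose_succ_succ, Int.cast_add, add_smul, Finset.sum_add_distrib, zchoose_zero_right,
    add_assoc]
  congr 1
  · refine Finset.sum_congr rfl fun i _ => ?_
    congr 2 <;> push_cast <;> ring
  · congr 1
    · refine Finset.sum_congr rfl fun i _ => ?_
      congr 2; push_cast; ring
    · congr 2; ring

theorem binomPairing_zero (F : ℤ → ℤ → W) (b c : ℤ) : binomPairing F 0 b c = F b c := by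
  unfold binomPairing
  rw [finsum_eq_single _ 0]
  · simp [zchoose_zero_right]
  · rintro (_ | i) hi
    · exact absurd rfl hi
    · simp [zchoose_zero_succ]

/-- The pairing of `A(x₁,x₂) ∈ W((x₁))((x₂))` with `x₁^a x₂^b (x₁-x₂)^c`. -/
def pairA (A : ℤ → ℤ → W) (a b c : ℤ) : W :=
  (-1 : ℂ) ^ b • binomPairing (fun m n => (-1 : ℂ) ^ m • A (-n - 1) (-m - 1)) c b a

/-- The pairing of `C(x₀,x₂) ∈ W((x₂))((x₀))` with `(x₂+x₀)^a x₂^b x₀^c`. -/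
def pairC (C : ℤ → ℤ → W) (a b c : ℤ) : W :=
  binomPairing (fun m n => C (-m - 1) (-n - 1)) a c b

theorem three_pairA {A : ℤ → ℤ → W} {N : ℤ} (hA : ∀ m n, n < N → A m n = 0) : Three (pairA A) :=
  (three_binomPairing (N := -N) fun m n h => by rw [hA _ _ (by omega), smul_zero]).reflect

theorem three_pairC {C : ℤ → ℤ → W} {N : ℤ} (hC : ∀ m n, m < N → C m n = 0) : Three (pairC C) :=
  (three_binomPairing (N := -N) fun m n h => by rw [hC _ _ (by omega)]).swap

theorem pairA_zero (A : ℤ → ℤ → W) (a b : ℤ) : pairA A a b 0 = A (-a - 1) (-b - 1) := by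
  rw [pairA, binomPairing_zero, neg_one_zpow_smul_smul]

theorem pairC_zero (C : ℤ → ℤ → W) (b c : ℤ) : pairC C 0 b c = C (-c - 1) (-b - 1) := by
  rw [pairC, binomPairing_zero]

theorem pairA_eq (A : ℤ → ℤ → W) (a b c : ℤ) :
    pairA A a b c = ∑ᶠ i : ℕ, ((-1 : ℂ) ^ i * ((zchoose c i : ℤ) : ℂ)) •
      A (i - a - c - 1) (-b - i - 1) := by
  unfold pairA binomPairing
  rw [smul_finsum]
  refine finsum_congr fun i => ?_
  rw [smul_smul, smul_smul, zpow_add₀ (by norm_num), zpow_natCast]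
  congr 1
  · linear_combination ((zchoose c i : ℤ) : ℂ) * (-1 : ℂ) ^ i * neg_one_zpow_mul_self b
  · ring_nf

theorem pairC_eq (C : ℤ → ℤ → W) (a b c : ℤ) :
    pairC C a b c = ∑ᶠ i : ℕ, ((zchoose a i : ℤ) : ℂ) • C (-c - i - 1) (i - a - b - 1) := by
  unfold pairC binomPairing
  refine finsum_congr fun i => ?_
  ring_nf

theorem pairA_eq_zero {A : ℤ → ℤ → W} {N : ℤ} (hA : ∀ m n, n < N → A m n = 0) {a b c : ℤ}
    (hb : -N ≤ b) : pairA A a b c = 0 := by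
  rw [pairA_eq, finsum_eq_zero_of_forall_eq_zero fun i => by rw [hA _ _ (by omega), smul_zero]]

theorem pairC_eq_zero {C : ℤ → ℤ → W} {N : ℤ} (hC : ∀ m n, m < N → C m n = 0) {a b c : ℤ}
    (hc : -N ≤ c) : pairC C a b c = 0 := by
  rw [pairC_eq, finsum_eq_zero_of_forall_eq_zero fun i => by rw [hC _ _ (by omega), smul_zero]]

/-- For fixed `b` and a lower bound on `a`, the pairing vanishes for large `c`. -/
theorem exists_pairA_eq_zero {A : ℤ → ℤ → W} {N : ℤ} (hA : ∀ m n, n < N → A m n = 0)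
    (hA' : ∀ n, IsLaurent fun m => A m n) (a b : ℤ) :
    ∃ c₀, ∀ c, c₀ ≤ c → pairA A a b c = 0 := by
  choose M hM using hA'
  simp only at hM
  obtain ⟨B, hB⟩ := ((Finset.range (-b - N).toNat).image
    fun i : ℕ => (i - a - M (-b - i - 1) : ℤ)).bddAbove
  refine ⟨B, fun c hc => ?_⟩
  rw [pairA_eq, finsum_eq_zero_of_forall_eq_zero fun i => ?_]
  rcases lt_or_ge i (-b - N).toNat with hi | hi
  · have : (i - a - M (-b - i - 1) : ℤ) ≤ B :=
      hB (Finset.mem_coe.2 (Finset.mem_image_of_mem _ (Finset.mem_range.2 hi)))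
    rw [hM (-b - i - 1) _ (by omega), smul_zero]
  · rw [hA _ _ (by omega), smul_zero]

theorem substAdd02_eq_pairA (A : ℤ → ℤ → W) (p q : ℤ) :
    substAdd02 A p q = pairA A 0 (-q - 1) (-p - 1) := by
  rw [pairA_eq]
  unfold substAdd02
  refine finsum_congr fun i => ?_
  have h := zchoose_reflect (-p - 1) i
  rw [show -(-p - 1) - 1 + i = p + i by ring] at h
  rw [h]
  push_cast
  congr 2 <;> ring

/-- The `(x₀+x₂)^k`-multiplied coefficients as pairings. -/
theorem mulAddPow_eq {P : ℤ → ℤ → ℤ → W} (hP : Three P) (k : ℕ) (F : ℤ → ℤ → W)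
    (hF : ∀ p q, F p q = P 0 (-q - 1) (-p - 1)) (p q : ℤ) :
    mulAddPow k F p q = P k (-q - 1) (-p - 1) := by
  have h := hP.iterate k 0 (-q - 1) (-p - 1)
  rw [zero_add] at h
  rw [h]
  unfold mulAddPow
  refine Finset.sum_congr rfl fun j _ => ?_
  rw [hF]
  congr 2 <;> ring

/-- The `(x₁-x₂)^k`-multiplied coefficients as pairings. -/
theorem mulSubPow_eq {P : ℤ → ℤ → ℤ → W} (hP : Three P) (k : ℕ) (F : ℤ → ℤ → W)
    (hF : ∀ m n, F m n = P (-m - 1) (-n - 1) 0) (m n : ℤ) :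
    mulSubPow k F m n = P (-m - 1) (-n - 1) k := by
  have h := hP.iterate' k (-m - 1) (-n - 1) 0
  rw [zero_add] at h
  rw [h]
  unfold mulSubPow
  refine Finset.sum_congr rfl fun j _ => ?_
  rw [hF]
  congr 2 <;> ring

end Pairing

/-! ### Convolution of Laurent series -/

section Conv

variable {A B C E F G : Type*} [AddCommGroup A] [Module ℂ A] [AddCommGroup B] [Module ℂ B]
  [AddCommGroup C] [Module ℂ C] [AddCommGroup E] [Module ℂ E] [AddCommGroup F] [Module ℂ F]
  [AddCommGroup G] [Module ℂ G]

/-- The product of the series `φ` and `ψ` with respect to the bilinear map `β`. -/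
def conv (β : A →ₗ[ℂ] B →ₗ[ℂ] C) (φ : ℤ → A) (ψ : ℤ → B) : ℤ → C := fun n =>
  ∑ᶠ p, β (φ p) (ψ (n - p))

/-- The series `φ(-x)`. -/
def negArg (φ : ℤ → A) : ℤ → A := fun n => (-1 : ℂ) ^ n • φ n

theorem IsLaurent.negArg {φ : ℤ → A} (h : IsLaurent φ) : IsLaurent (negArg φ) := by
  obtain ⟨N, hN⟩ := h
  exact ⟨N, fun n hn => by simp [_root_.negArg, hN n hn]⟩

theorem IsLaurent.add {A : Type*} [AddCommGroup A] {φ ψ : ℤ → A} (h : IsLaurent φ)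
    (h' : IsLaurent ψ) : IsLaurent (φ + ψ) := by
  obtain ⟨N, hN⟩ := h
  obtain ⟨M, hM⟩ := h'
  exact ⟨min N M, fun n hn => by
    rw [Pi.add_apply, hN n (by omega), hM n (by omega), add_zero]⟩

theorem IsLaurent.smul {φ : ℤ → A} (h : IsLaurent φ) (c : ℂ) : IsLaurent (c • φ) := by
  obtain ⟨N, hN⟩ := h
  exact ⟨N, fun n hn => by rw [Pi.smul_apply, hN n hn, smul_zero]⟩

theorem isLaurent_zero {A : Type*} [AddCommGroup A] : IsLaurent (0 : ℤ → A) := ⟨0, fun _ _ => rfl⟩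

theorem isLaurent_sum {A ι : Type*} [AddCommGroup A] (s : Finset ι) {φ : ι → ℤ → A}
    (h : ∀ i ∈ s, IsLaurent (φ i)) :
    IsLaurent (∑ i ∈ s, φ i) :=
  Finset.sum_induction _ IsLaurent (fun _ _ => IsLaurent.add) isLaurent_zero h

theorem conv_hasFiniteSupport (β : A →ₗ[ℂ] B →ₗ[ℂ] C) {φ : ℤ → A} {ψ : ℤ → B} (hφ : IsLaurent φ)
    (hψ : IsLaurent ψ) (n : ℤ) : (fun p => β (φ p) (ψ (n - p))).HasFiniteSupport := by
  obtain ⟨N, hN⟩ := hφ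
  obtain ⟨M, hM⟩ := hψ
  refine (Set.finite_Icc N (n - M)).subset fun p hp => ?_
  by_contra hc
  rw [Set.mem_Icc, not_and_or] at hc
  apply hp
  rcases hc with hc | hc
  · simp [hN p (by omega)]
  · simp [hM (n - p) (by omega)]

theorem IsLaurent.conv (β : A →ₗ[ℂ] B →ₗ[ℂ] C) {φ : ℤ → A} {ψ : ℤ → B} (hφ : IsLaurent φ)
    (hψ : IsLaurent ψ) : IsLaurent (conv β φ ψ) := by
  obtain ⟨N, hN⟩ := hφ
  obtain ⟨M, hM⟩ := hψ
  refine ⟨N + M, fun n hn => finsum_eq_zero_of_forall_eq_zero fun p => ?_⟩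
  rcases lt_or_ge p N with h | h
  · simp [hN p h]
  · simp [hM (n - p) (by omega)]

theorem conv_add_left (β : A →ₗ[ℂ] B →ₗ[ℂ] C) {φ φ' : ℤ → A} {ψ : ℤ → B} (hφ : IsLaurent φ)
    (hφ' : IsLaurent φ') (hψ : IsLaurent ψ) : conv β (φ + φ') ψ = conv β φ ψ + conv β φ' ψ := by
  funext n
  simp only [conv, Pi.add_apply, map_add, LinearMap.add_apply]
  exact finsum_add_distrib (conv_hasFiniteSupport β hφ hψ n) (conv_hasFiniteSupport β hφ' hψ n)

theorem conv_flip (β : A →ₗ[ℂ] B →ₗ[ℂ] C) (φ : ℤ → A) (ψ : ℤ → B) :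
    conv β.flip ψ φ = conv β φ ψ := by
  funext n
  unfold conv
  rw [← finsum_comp_equiv (Equiv.subLeft n)]
  simp

theorem conv_add_right (β : A →ₗ[ℂ] B →ₗ[ℂ] C) {φ : ℤ → A} {ψ ψ' : ℤ → B} (hφ : IsLaurent φ)
    (hψ : IsLaurent ψ) (hψ' : IsLaurent ψ') : conv β φ (ψ + ψ') = conv β φ ψ + conv β φ ψ' := by
  rw [← conv_flip, conv_add_left _ hψ hψ' hφ, conv_flip, conv_flip]

theorem conv_smul_left (β : A →ₗ[ℂ] B →ₗ[ℂ] C) (c : ℂ) (φ : ℤ → A) (ψ : ℤ → B) :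
    conv β (c • φ) ψ = c • conv β φ ψ := by
  funext n
  simp only [conv, Pi.smul_apply, map_smul, LinearMap.smul_apply, smul_finsum]

theorem conv_smul_right (β : A →ₗ[ℂ] B →ₗ[ℂ] C) (c : ℂ) (φ : ℤ → A) (ψ : ℤ → B) :
    conv β φ (c • ψ) = c • conv β φ ψ := by
  rw [← conv_flip, conv_smul_left, conv_flip]

theorem conv_zero_right (β : A →ₗ[ℂ] B →ₗ[ℂ] C) (φ : ℤ → A) : conv β φ 0 = 0 := by
  funext n; simp [conv]

theorem conv_zero_left (β : A →ₗ[ℂ] B →ₗ[ℂ] C) (ψ : ℤ → B) : conv β 0 ψ = 0 := by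
  funext n; simp [conv]

theorem conv_sum_right (β : A →ₗ[ℂ] B →ₗ[ℂ] C) {ι : Type*} (s : Finset ι) {φ : ℤ → A}
    {ψ : ι → ℤ → B} (hφ : IsLaurent φ) (hψ : ∀ i ∈ s, IsLaurent (ψ i)) :
    conv β φ (∑ i ∈ s, ψ i) = ∑ i ∈ s, conv β φ (ψ i) := by
  classical
  induction s using Finset.induction_on with
  | empty => simp [conv_zero_right]
  | insert i s hi ih =>
    rw [Finset.sum_insert hi, Finset.sum_insert hi, conv_add_right β hφ
      (hψ i (Finset.mem_insert_self i s))
      (isLaurent_sum s fun j hj => hψ j (Finset.mem_insert_of_mem hj)),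
      ih fun j hj => hψ j (Finset.mem_insert_of_mem hj)]

theorem conv_negArg (β : A →ₗ[ℂ] B →ₗ[ℂ] C) (φ : ℤ → A) (ψ : ℤ → B) :
    conv β (negArg φ) (negArg ψ) = negArg (conv β φ ψ) := by
  funext n
  simp only [conv, negArg, smul_finsum, map_smul, LinearMap.smul_apply, smul_smul]
  refine finsum_congr fun p => ?_
  rw [← zpow_add₀ (by norm_num), sub_add_cancel]

theorem conv_assoc (β₁ : A →ₗ[ℂ] B →ₗ[ℂ] E) (β₂ : E →ₗ[ℂ] C →ₗ[ℂ] F) (β₃ : B →ₗ[ℂ] C →ₗ[ℂ] G)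
    (β₄ : A →ₗ[ℂ] G →ₗ[ℂ] F) (h : ∀ a b c, β₂ (β₁ a b) c = β₄ a (β₃ b c))
    {φ : ℤ → A} {ψ : ℤ → B} {χ : ℤ → C} (hφ : IsLaurent φ) (hψ : IsLaurent ψ) (hχ : IsLaurent χ) :
    conv β₂ (conv β₁ φ ψ) χ = conv β₄ φ (conv β₃ ψ χ) := by
  funext n
  have h1 : ∀ p, β₂ (conv β₁ φ ψ p) (χ (n - p))
      = ∑ᶠ q, β₄ (φ q) (β₃ (ψ (p - q)) (χ (n - p))) := fun p => by
    have e := (β₂.flip (χ (n - p))).toAddMonoidHom.map_finsum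
      (conv_hasFiniteSupport β₁ hφ hψ p)
    simp only [LinearMap.toAddMonoidHom_coe, LinearMap.flip_apply, h] at e
    exact e
  have h2 : ∀ q, β₄ (φ q) (conv β₃ ψ χ (n - q))
      = ∑ᶠ p, β₄ (φ q) (β₃ (ψ (p - q)) (χ (n - p))) := fun q => by
    have e := (β₄ (φ q)).toAddMonoidHom.map_finsum (conv_hasFiniteSupport β₃ hψ hχ (n - q))
    simp only [LinearMap.toAddMonoidHom_coe] at e
    refine e.trans ?_
    rw [← finsum_int_shift _ (-q)]
    refine finsum_congr fun p => ?_
    congr 3; ring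
  unfold conv at h1 h2 ⊢
  simp only [h1, h2]
  obtain ⟨N, hN⟩ := hφ
  obtain ⟨M, hM⟩ := hψ
  obtain ⟨L, hL⟩ := hχ
  refine finsum_swap _ (Set.Icc (N + M) (n - L)) (Set.Icc N (n - L - M)) (Set.finite_Icc _ _)
    (Set.finite_Icc _ _) fun p q hpq => ?_
  have a1 : N ≤ q := by
    by_contra hc; exact hpq (by simp [hN q (by omega)])
  have a2 : M ≤ p - q := by
    by_contra hc; exact hpq (by simp [hM (p - q) (by omega)])
  have a3 : L ≤ n - p := by
    by_contra hc; exact hpq (by simp [hL (n - p) (by omega)])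
  simp only [Set.mem_Icc]; omega

theorem conv_left_comm (β₁ : A →ₗ[ℂ] B →ₗ[ℂ] E) (β₂ : C →ₗ[ℂ] E →ₗ[ℂ] F)
    (β₃ : C →ₗ[ℂ] B →ₗ[ℂ] G) (β₄ : A →ₗ[ℂ] G →ₗ[ℂ] F)
    (h : ∀ a b c, β₂ c (β₁ a b) = β₄ a (β₃ c b))
    {φ : ℤ → A} {ψ : ℤ → B} {χ : ℤ → C} (hφ : IsLaurent φ) (hψ : IsLaurent ψ) (hχ : IsLaurent χ) :
    conv β₂ χ (conv β₁ φ ψ) = conv β₄ φ (conv β₃ χ ψ) := by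
  rw [← conv_flip β₂, ← conv_flip β₃]
  exact conv_assoc β₁ β₂.flip β₃.flip β₄ h hφ hψ hχ

end Conv

section ShiftSum

variable {W : Type*} [AddCommGroup W] [Module ℂ W]

theorem shiftSum_hasFiniteSupport {f : ℤ → ℂ} (hf : IsLaurent f) {P : ℤ → W}
    (hP : ∃ c₀, ∀ c, c₀ ≤ c → P c = 0) (c : ℤ) :
    (fun p => f p • P (c + p)).HasFiniteSupport := by
  obtain ⟨N, hN⟩ := hf
  obtain ⟨c₀, hc₀⟩ := hP
  refine (Set.finite_Icc N (c₀ - c)).subset fun p hp => ?_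
  by_contra hc
  rw [Set.mem_Icc, not_and_or] at hc
  apply hp
  rcases hc with hc | hc
  · simp [hN p (by omega)]
  · simp [hc₀ (c + p) (by omega)]

/-- The three term relation is preserved by multiplication with `f(x₀)`. -/
theorem Three.shiftSum {P : ℤ → ℤ → ℤ → W} (hP : Three P) {f : ℤ → ℂ} (hf : IsLaurent f)
    (h : ∀ a b, ∃ c₀, ∀ c, c₀ ≤ c → P a b c = 0) :
    Three fun a b c => ∑ᶠ p, f p • P a b (c + p) := by
  intro a b c
  simp only
  rw [← finsum_add_distrib (shiftSum_hasFiniteSupport hf (h _ _) _)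
    (shiftSum_hasFiniteSupport hf (h _ _) _)]
  refine finsum_congr fun p => ?_
  rw [hP, smul_add, add_right_comm c 1 p]

theorem scalarMulSub_eq {f : ℤ → ℂ} (hf : IsLaurent f) {B : ℤ → ℤ → W} {N : ℤ}
    (hB : ∀ m n, n < N → B m n = 0) (hB' : ∀ n, IsLaurent fun m => B m n) (m n : ℤ) :
    scalarMulSub f (fun a b => B b a) m n = ∑ᶠ p, f p • pairA B (-n - 1) (-m - 1) p := by
  unfold scalarMulSub
  simp only [pairA_eq, smul_finsum]
  obtain ⟨L, hL⟩ := hf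
  choose M hM using hB'
  simp only at hM
  obtain ⟨T, hT⟩ := ((Finset.range ((m - N).toNat + 1)).image
    fun i : ℕ => (n + i - M (m - i) : ℤ)).bddAbove
  rw [finsum_swap _ (Finset.range ((m - N).toNat + 1) : Set ℕ) (Set.Icc L T)
    (Finset.finite_toSet _) (Set.finite_Icc _ _)]
  · refine finsum_congr fun p => finsum_congr fun i => ?_
    rw [smul_smul]
    congr 1
    · ring
    · ring_nf
  · intro i p hip
    have h1 : N ≤ m - i := by
      by_contra hc; exact hip (by rw [hB _ _ (by omega), smul_zero])
    have h2 : L ≤ p := by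
      by_contra hc; exact hip (by rw [hL _ (by omega), mul_zero, zero_smul])
    have h3 : M (m - i) ≤ n - p + i := by
      by_contra hc; exact hip (by rw [hM _ _ (by omega), smul_zero])
    have hi : i ∈ Finset.range ((m - N).toNat + 1) := by rw [Finset.mem_range]; omega
    have h4 : (n + i - M (m - i) : ℤ) ≤ T := hT (Finset.mem_coe.2 (Finset.mem_image_of_mem _ hi))
    exact ⟨hi, by rw [Set.mem_Icc]; omega⟩

end ShiftSum

namespace NLVA

variable {V : Type*} [AddCommGroup V] [Module ℂ V] (𝒱 : NLVA V)

/-! ### Products and iterates of vertex operators -/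

/-- The pairing of `Y(u,x₁)Y(v,x₂)w` with `x₁^a x₂^b (x₁-x₂)^c`. -/
def prodPair (u v w : V) : ℤ → ℤ → ℤ → V := pairA fun m n => 𝒱.Y u (𝒱.Y v w n) m

/-- The pairing of `Y(φ(x₀),x₂)w` with `(x₂+x₀)^a x₂^b x₀^c`. -/
def iterPair (φ : ℤ → V) (w : V) : ℤ → ℤ → ℤ → V := pairC fun m n => 𝒱.Y (φ m) w n

theorem exists_product_trunc (u v w : V) : ∃ N : ℤ, ∀ m n, n < N → 𝒱.Y u (𝒱.Y v w n) m = 0 := by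
  obtain ⟨N, hN⟩ := 𝒱.trunc v w
  exact ⟨N, fun m n hn => by rw [hN n hn]; simp⟩

theorem three_prodPair (u v w : V) : Three (𝒱.prodPair u v w) :=
  let ⟨_, hN⟩ := 𝒱.exists_product_trunc u v w
  three_pairA hN

theorem exists_iterate_trunc {φ : ℤ → V} (hφ : IsLaurent φ) :
    ∃ N : ℤ, ∀ w m n, m < N → 𝒱.Y (φ m) w n = 0 := by
  obtain ⟨N, hN⟩ := hφ
  exact ⟨N, fun w m n hm => by rw [hN m hm]; simp⟩

theorem three_iterPair {φ : ℤ → V} (hφ : IsLaurent φ) (w : V) : Three (𝒱.iterPair φ w) :=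
  let ⟨_, hN⟩ := 𝒱.exists_iterate_trunc hφ
  three_pairC (hN w)

theorem exists_prodPair_eq_zero (u v w : V) : ∃ b₀, ∀ a b c, b₀ ≤ b → 𝒱.prodPair u v w a b c = 0 :=
  let ⟨N, hN⟩ := 𝒱.exists_product_trunc u v w
  ⟨-N, fun _ _ _ h => pairA_eq_zero hN h⟩

theorem exists_prodPair_eq_zero' (u v w : V) (a b : ℤ) :
    ∃ c₀, ∀ c, c₀ ≤ c → 𝒱.prodPair u v w a b c = 0 :=
  let ⟨_, hN⟩ := 𝒱.exists_product_trunc u v w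
  exists_pairA_eq_zero hN (fun n => 𝒱.trunc u (𝒱.Y v w n)) a b

theorem exists_iterPair_eq_zero {φ : ℤ → V} (hφ : IsLaurent φ) :
    ∃ c₀, ∀ w a b c, c₀ ≤ c → 𝒱.iterPair φ w a b c = 0 :=
  let ⟨N, hN⟩ := 𝒱.exists_iterate_trunc hφ
  ⟨-N, fun w _ _ _ h => pairC_eq_zero (hN w) h⟩

theorem iterPair_zero (φ : ℤ → V) (w : V) (b c : ℤ) :
    𝒱.iterPair φ w 0 b c = 𝒱.Y (φ (-c - 1)) w (-b - 1) :=
  pairC_zero _ b c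

theorem iterPair_eq (φ : ℤ → V) (w : V) (a b c : ℤ) :
    𝒱.iterPair φ w a b c = ∑ᶠ i : ℕ, ((zchoose a i : ℤ) : ℂ) •
      𝒱.Y (φ (-c - i - 1)) w (i - a - b - 1) :=
  pairC_eq _ a b c

theorem iterPair_add {φ ψ : ℤ → V} (hφ : IsLaurent φ) (hψ : IsLaurent ψ) (w : V) (a b c : ℤ) :
    𝒱.iterPair (φ + ψ) w a b c = 𝒱.iterPair φ w a b c + 𝒱.iterPair ψ w a b c := by
  have fin : ∀ {φ : ℤ → V}, IsLaurent φ → (fun i : ℕ => ((zchoose a i : ℤ) : ℂ) •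
      𝒱.Y (φ (-c - i - 1)) w (i - a - b - 1)).HasFiniteSupport := by
    rintro φ ⟨N, hN⟩
    refine (Set.finite_Iic (-c - N).toNat).subset fun i hi => ?_
    by_contra hc
    rw [Set.mem_Iic] at hc
    exact hi (by simp [hN (-c - i - 1) (by omega)])
  simp only [iterPair_eq, Pi.add_apply, map_add, LinearMap.add_apply, smul_add]
  exact finsum_add_distrib (fin hφ) (fin hψ)

theorem iterPair_sum {ι : Type*} (s : Finset ι) {φ : ι → ℤ → V} (hφ : ∀ i, IsLaurent (φ i))
    (w : V) (a b c : ℤ) :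
    𝒱.iterPair (∑ i ∈ s, φ i) w a b c = ∑ i ∈ s, 𝒱.iterPair (φ i) w a b c := by
  classical
  induction s using Finset.induction_on with
  | empty => simp [iterPair_eq]
  | insert i s hi ih =>
    rw [Finset.sum_insert hi, Finset.sum_insert hi,
      𝒱.iterPair_add (hφ i) (isLaurent_sum s fun j _ => hφ j), ih]

theorem iterPair_conv {f : ℤ → ℂ} (hf : IsLaurent f) {φ : ℤ → V} (hφ : IsLaurent φ) (w : V)
    (a b c : ℤ) : 𝒱.iterPair (conv (LinearMap.lsmul ℂ V) f φ) w a b c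
      = ∑ᶠ p, f p • 𝒱.iterPair φ w a b (c + p) := by
  have h1 : ∀ n j, 𝒱.Y (conv (LinearMap.lsmul ℂ V) f φ n) w j
      = ∑ᶠ p, f p • 𝒱.Y (φ (n - p)) w j := fun n j => by
    have e := ((𝒱.Yc j).flip w).toAddMonoidHom.map_finsum
      (conv_hasFiniteSupport (LinearMap.lsmul ℂ V) hf hφ n)
    simpa [NLVA.Yc, conv] using e
  simp only [iterPair_eq, h1, smul_finsum]
  obtain ⟨N, hN⟩ := hf
  obtain ⟨M, hM⟩ := hφ
  rw [finsum_swap _ (Set.Iic (-c - N - M).toNat) (Set.Icc N (-c - 1 - M)) (Set.finite_Iic _)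
    (Set.finite_Icc _ _)]
  · refine finsum_congr fun p => finsum_congr fun i => ?_
    rw [smul_comm]
    ring_nf
  · intro i p hip
    have h2 : N ≤ p := by
      by_contra hc; exact hip (by simp [hN p (by omega)])
    have h3 : M ≤ -c - i - 1 - p := by
      by_contra hc; exact hip (by simp [hM (-c - i - 1 - p) (by omega)])
    simp only [Set.mem_Iic, Set.mem_Icc]
    omega

theorem exists_prodPair_eq_iterPair (u v w : V) :
    ∃ l, ∀ a b c, l ≤ a → 𝒱.prodPair u v w a b c = 𝒱.iterPair (𝒱.Y u v) w a b c := by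
  obtain ⟨k, hk⟩ := 𝒱.weak_assoc u v w
  have h3 := 𝒱.three_iterPair (𝒱.trunc u v) w
  refine ⟨k, fun a b c ha => sub_eq_zero.1 <|
    ((𝒱.three_prodPair u v w).sub h3).vanish_of_le_a k (fun b c => sub_eq_zero.2 ?_) a b c ha⟩
  have e := hk (-c - 1) (-b - 1)
  rw [mulAddPow_eq (𝒱.three_prodPair u v w) k _ fun p q => substAdd02_eq_pairA _ p q,
    mulAddPow_eq h3 k _ fun p q => ?_] at e
  · convert e using 1 <;> ring_nf
  · rw [iterPair_zero]
    ring_nf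

theorem prodPair_one_middle (v w : V) (a b c : ℤ) :
    𝒱.prodPair v 𝒱.one w a b c = if b < 0 then
      ((-1 : ℂ) ^ (-b - 1).toNat * ((zchoose c (-b - 1).toNat : ℤ) : ℂ)) •
        𝒱.Y v w (-a - b - c - 2) else 0 := by
  rw [prodPair, pairA_eq]
  simp only [𝒱.vacuum_left]
  split_ifs with hb
  · rw [finsum_eq_single _ (-b - 1).toNat]
    · rw [if_pos (by omega), show ((-b - 1).toNat : ℤ) - a - c - 1 = -a - b - c - 2 by omega]
    · intro i hi
      rw [if_neg (by omega)]
      simp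
  · refine finsum_eq_zero_of_forall_eq_zero fun i => ?_
    rw [if_neg (by omega)]
    simp

/-- `Y(e^{zD}v, x) = Y(v, x + z)`. -/
theorem Y_creation (v w : V) (i : ℕ) (n : ℤ) :
    𝒱.Y (𝒱.Y v 𝒱.one i) w n = ((zchoose (n + i) i : ℤ) : ℂ) • 𝒱.Y v w (n + i) := by
  obtain ⟨M, hM⟩ := 𝒱.trunc v w
  obtain ⟨l, hl⟩ := 𝒱.exists_prodPair_eq_iterPair v 𝒱.one w
  let E : ℤ → ℤ → ℤ → V := fun a b c => if c < 0 then
    ((zchoose (-b - c - 2) (-c - 1).toNat : ℤ) : ℂ) • 𝒱.Y v w (-a - b - c - 2) else 0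
  have hE : Three E := by
    intro a b c
    simp only [E]
    rcases lt_trichotomy (c + 1) 0 with hc | hc | hc
    · rw [if_pos (by omega), if_pos (by omega), if_pos hc,
        show (-c - 1).toNat = (-(c + 1) - 1).toNat + 1 by omega,
        show -b - c - 2 = (-b - (c + 1) - 2) + 1 by ring, zchoose_succ_succ,
        show -(b + 1) - c - 2 = -b - (c + 1) - 2 by ring, Int.cast_add, add_smul, add_comm]
      ring_nf
    · rw [if_pos (by omega), if_pos (by omega), if_neg (by omega), add_zero,
        show (-c - 1).toNat = 0 by omega, zchoose_zero_right, zchoose_zero_right]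
      ring_nf
    · rw [if_neg (by omega), if_neg (by omega), if_neg (by omega), add_zero]
  have h3 : Three (𝒱.iterPair (𝒱.Y v 𝒱.one) w) := 𝒱.three_iterPair (𝒱.trunc v 𝒱.one) w
  have key := (hE.sub h3).vanish_ac (max l (-M)) 0 (fun a b c ha => ?_) (fun a b c hc => ?_) 0
    (-n - 1) (-i - 1)
  · rw [iterPair_zero, sub_eq_zero] at key
    simp only [E] at key
    rw [if_pos (by omega)] at key
    rw [show -(-(i : ℤ) - 1) - 1 = i by ring, show -(-n - 1) - 1 = n by ring] at key
    rw [← key]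
    have e1 : (i : ℤ).toNat = i := by simp
    rw [e1]
    ring_nf
  · rw [← hl a b c (by omega), prodPair_one_middle, sub_eq_zero]
    simp only [E]
    by_cases hc : c < 0 <;> by_cases hb : b < 0
    · obtain ⟨j, rfl⟩ : ∃ j : ℕ, b = -(j : ℤ) - 1 := ⟨(-b - 1).toNat, by omega⟩
      obtain ⟨k, rfl⟩ : ∃ k : ℕ, c = -(k : ℤ) - 1 := ⟨(-c - 1).toNat, by omega⟩
      rw [if_pos hc, if_pos hb, show (-(-(j : ℤ) - 1) - 1).toNat = j by omega,
        show (-(-(k : ℤ) - 1) - 1).toNat = k by omega, zchoose_negSucc,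
        show -(-(j : ℤ) - 1) - (-(k : ℤ) - 1) - 2 = ((j + k : ℕ) : ℤ) by push_cast; ring,
        zchoose_natCast]
      congr 1
      push_cast
      rw [← mul_assoc, ← mul_pow, add_comm k j, ← Nat.choose_symm_add]
      simp
    · rw [if_pos hc, if_neg hb]
      rcases lt_or_ge (-b - c - 2) 0 with h | h
      · rw [hM _ (by omega), smul_zero]
      · obtain ⟨j, hj⟩ := Int.eq_ofNat_of_zero_le h
        rw [hj, zchoose_natCast, Nat.choose_eq_zero_of_lt (by omega)]
        simp
    · rw [if_neg hc, if_pos hb]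
      rcases lt_or_ge c (-b - 1) with h | h
      · lift c to ℕ using (by omega)
        rw [zchoose_natCast, Nat.choose_eq_zero_of_lt (by omega)]
        simp
      · rw [hM _ (by omega), smul_zero]
    · rw [if_neg hc, if_neg hb]
  · simp only [E]
    rw [if_neg (by omega), zero_sub, neg_eq_zero]
    exact pairC_eq_zero (N := 0) (fun m n hm => by
      rw [𝒱.creation_reg v m hm]; simp) (by omega)

theorem prodPair_vac_eq_zero (u v : V) (a b c : ℤ) (hb : 0 ≤ b) :
    𝒱.prodPair u v 𝒱.one a b c = 0 :=
  pairA_eq_zero (N := 0) (fun m n hn => by rw [𝒱.creation_reg v n hn]; simp) (by omega)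

theorem iterPair_vac_eq_zero (φ : ℤ → V) (a b c : ℤ) (ha : 0 ≤ a) (hb : 0 ≤ b) :
    𝒱.iterPair φ 𝒱.one a b c = 0 := by
  rw [iterPair_eq]
  refine finsum_eq_zero_of_forall_eq_zero fun i => ?_
  lift a to ℕ using ha
  rcases lt_or_ge a i with h | h
  · rw [zchoose_natCast, Nat.choose_eq_zero_of_lt h]; simp
  · rw [𝒱.creation_reg _ _ (by omega), smul_zero]

theorem prodPair_vac (u v : V) (a b c : ℤ) (ha : 0 ≤ a) :
    𝒱.prodPair u v 𝒱.one a b c = 𝒱.iterPair (𝒱.Y u v) 𝒱.one a b c := by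
  obtain ⟨l, hl⟩ := 𝒱.exists_prodPair_eq_iterPair u v 𝒱.one
  refine sub_eq_zero.1 (((𝒱.three_prodPair u v 𝒱.one).sub
    (𝒱.three_iterPair (𝒱.trunc u v) 𝒱.one)).vanish_ab_of_le l 0 0
    (fun a b c h => sub_eq_zero.2 (hl a b c h)) (fun a b c ha hb => ?_) a b c ha)
  rw [𝒱.prodPair_vac_eq_zero u v a b c hb, 𝒱.iterPair_vac_eq_zero _ a b c ha hb, sub_zero]

end NLVA

namespace NLVA

variable {V : Type*} [AddCommGroup V] [Module ℂ V] (𝒱 : NLVA V)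

/-! ### `𝒮`-locality and skew symmetry -/

section Opposite

variable {ι : Type*} [Fintype ι] {f : ι → ℤ → ℂ} (t s : ι → V)

variable (f) in
/-- The pairing of `∑ i, f_i(x₂-x₁) Y(t_i,x₂)Y(s_i,x₁)w` with `x₁^a x₂^b (x₁-x₂)^c`. -/
def oppPair (w : V) (a b c : ℤ) : V :=
  (-1 : ℂ) ^ c • ∑ i, ∑ᶠ p, f i p • 𝒱.prodPair (t i) (s i) w b a (c + p)

variable (f) in
/-- The series `∑ i, f_i(x) Y(t_i,x)s_i`. -/
def oppSeries : ℤ → V := ∑ i, conv (LinearMap.lsmul ℂ V) (f i) (𝒱.Y (t i) (s i))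

theorem isLaurent_oppSeries (hf : ∀ i, IsLaurent (f i)) : IsLaurent (𝒱.oppSeries f t s) :=
  isLaurent_sum _ fun i _ => (hf i).conv _ (𝒱.trunc _ _)

theorem three_oppPair (hf : ∀ i, IsLaurent (f i)) (w : V) : Three (𝒱.oppPair f t s w) :=
  (Three.sum fun i _ => (𝒱.three_prodPair (t i) (s i) w).shiftSum (hf i)
    (𝒱.exists_prodPair_eq_zero' (t i) (s i) w)).reflect'

theorem oppPair_eq_zero {w : V} {a b : ℤ} (h : ∀ i c, 𝒱.prodPair (t i) (s i) w b a c = 0)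
    (c : ℤ) : 𝒱.oppPair f t s w a b c = 0 := by
  simp [oppPair, h]

theorem exists_oppPair_eq_zero (w : V) :
    ∃ a₀, ∀ a b c, a₀ ≤ a → 𝒱.oppPair f t s w a b c = 0 := by
  choose B hB using fun i => 𝒱.exists_prodPair_eq_zero (t i) (s i) w
  obtain ⟨a₀, ha₀⟩ := Finite.exists_le B
  exact ⟨a₀, fun a b c ha => 𝒱.oppPair_eq_zero t s
    (fun i c => hB i _ _ _ ((ha₀ i).trans ha)) c⟩

theorem oppPair_eq_iterPair (hf : ∀ i, IsLaurent (f i)) {w : V} {a b : ℤ}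
    (h : ∀ i c, 𝒱.prodPair (t i) (s i) w b a c = 𝒱.iterPair (𝒱.Y (t i) (s i)) w b a c) (c : ℤ) :
    𝒱.oppPair f t s w a b c = (-1 : ℂ) ^ c • 𝒱.iterPair (𝒱.oppSeries f t s) w b a c := by
  rw [oppPair, oppSeries, iterPair_sum _ _ fun i => (hf i).conv _ (𝒱.trunc _ _)]
  congr 1
  refine Finset.sum_congr rfl fun i _ => ?_
  rw [𝒱.iterPair_conv (hf i) (𝒱.trunc _ _)]
  exact finsum_congr fun p => by rw [h]

theorem exists_oppPair_eq_iterPair (hf : ∀ i, IsLaurent (f i)) (w : V) :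
    ∃ b₀, ∀ a b c, b₀ ≤ b →
      𝒱.oppPair f t s w a b c = (-1 : ℂ) ^ c • 𝒱.iterPair (𝒱.oppSeries f t s) w b a c := by
  choose B hB using fun i => 𝒱.exists_prodPair_eq_iterPair (t i) (s i) w
  obtain ⟨b₀, hb₀⟩ := Finite.exists_le B
  exact ⟨b₀, fun a b c hb => 𝒱.oppPair_eq_iterPair t s hf
    (fun i c => hB i _ _ _ ((hb₀ i).trans hb)) c⟩

theorem locality_iff_pair (hf : ∀ i, IsLaurent (f i)) (u v w : V) (k : ℕ) :
    (∀ m n : ℤ, mulSubPow k (fun a b => 𝒱.Y u (𝒱.Y v w b) a) m n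
        = mulSubPow k (fun a b => ∑ i, scalarMulSub (f i)
            (fun a' b' => 𝒱.Y (t i) (𝒱.Y (s i) w a') b') a b) m n) ↔
      ∀ a b, 𝒱.prodPair u v w a b k = 𝒱.oppPair f t s w a b k := by
  have h1 : ∀ m n, mulSubPow k (fun a b => 𝒱.Y u (𝒱.Y v w b) a) m n
      = 𝒱.prodPair u v w (-m - 1) (-n - 1) k :=
    mulSubPow_eq (𝒱.three_prodPair u v w) k _ fun m n => by
      rw [prodPair, pairA_zero]; ring_nf
  have h2 : ∀ m n, mulSubPow k (fun a b => ∑ i, scalarMulSub (f i)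
      (fun a' b' => 𝒱.Y (t i) (𝒱.Y (s i) w a') b') a b) m n
      = 𝒱.oppPair f t s w (-m - 1) (-n - 1) k :=
    mulSubPow_eq (𝒱.three_oppPair t s hf w) k _ fun m n => by
      simp only [oppPair, zpow_zero, one_smul, zero_add]
      refine Finset.sum_congr rfl fun i _ => ?_
      obtain ⟨N, hN⟩ := 𝒱.exists_product_trunc (t i) (s i) w
      exact scalarMulSub_eq (hf i) hN (fun n => 𝒱.trunc _ _) m n
  simp only [h1, h2]
  refine ⟨fun h a b => ?_, fun h m n => h _ _⟩
  simpa using h (-a - 1) (-b - 1)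

end Opposite

/-- The series `e^{xD}`. -/
def expD (n : ℤ) : V →ₗ[ℂ] V := (𝒱.Yc n).flip 𝒱.one

theorem expD_apply (n : ℤ) (v : V) : 𝒱.expD n v = 𝒱.Y v 𝒱.one n := rfl

theorem isLaurent_expD : IsLaurent 𝒱.expD :=
  ⟨0, fun n hn => LinearMap.ext fun v => 𝒱.creation_reg v n hn⟩

/-- The series `e^{xD} φ(-x)`. -/
def skew (φ : ℤ → V) : ℤ → V := conv LinearMap.id 𝒱.expD (negArg φ)

theorem skew_apply (φ : ℤ → V) (n : ℤ) :
    𝒱.skew φ n = ∑ᶠ i : ℕ, (-1 : ℂ) ^ (n - i) • 𝒱.Y (φ (n - i)) 𝒱.one i := by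
  unfold skew conv
  rw [finsum_int_eq_nat]
  · simp [negArg, expD_apply]
  · intro p hp
    simp [expD_apply, 𝒱.creation_reg _ p hp]

theorem iterPair_skew {φ : ℤ → V} (hφ : IsLaurent φ) (w : V) (b c : ℤ) :
    𝒱.iterPair (𝒱.skew φ) w 0 b c + (-1 : ℂ) ^ c • 𝒱.iterPair φ w b 0 c = 0 := by
  obtain ⟨N, hN⟩ := hφ
  have fin : (fun i : ℕ => (-1 : ℂ) ^ (-c - 1 - i) •
      𝒱.Y (φ (-c - 1 - i)) 𝒱.one i).HasFiniteSupport := by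
    refine (Set.finite_Iic (-c - N).toNat).subset fun i hi => ?_
    by_contra hc
    rw [Set.mem_Iic] at hc
    exact hi (by simp [hN (-c - 1 - i) (by omega)])
  have e := ((𝒱.Yc (-b - 1)).flip w).toAddMonoidHom.map_finsum fin
  simp only [LinearMap.toAddMonoidHom_coe, LinearMap.flip_apply, ← skew_apply] at e
  rw [iterPair_zero]
  refine (congrArg₂ (· + ·) e rfl).trans ?_
  rw [iterPair_eq, add_eq_zero_iff_eq_neg, smul_finsum, ← finsum_neg_distrib]
  refine finsum_congr fun i => ?_
  rw [map_smul, LinearMap.smul_apply]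
  change _ • 𝒱.Y (𝒱.Y (φ (-c - 1 - i)) 𝒱.one i) w (-b - 1) = _
  rw [Y_creation, zchoose_reflect, smul_smul, smul_smul, ← neg_smul]
  congr 1
  · have e1 : (-1 : ℂ) ^ (-c - 1 - (i : ℤ)) * (-1 : ℂ) ^ (c + (i : ℤ)) = -1 := by
      rw [← zpow_add₀ (by norm_num), show -c - 1 - (i : ℤ) + (c + i) = -1 by ring]
      norm_num
    have e2 := neg_one_zpow_mul_self (c + i)
    have e3 : (-1 : ℂ) ^ i * (-1 : ℂ) ^ i = 1 := by rw [← mul_pow]; norm_num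
    rw [zpow_add₀ (by norm_num), zpow_natCast] at e1 e2
    have e4 : (-1 : ℂ) ^ (-c - 1 - (i : ℤ)) = -((-1 : ℂ) ^ c * (-1 : ℂ) ^ i) := by
      linear_combination (-(-1 : ℂ) ^ (-c - 1 - (i : ℤ))) * e2 + (-1 : ℂ) ^ c * (-1 : ℂ) ^ i * e1
    rw [e4]
    push_cast
    linear_combination (-(-1 : ℂ) ^ c * (zchoose b i : ℂ)) * e3
  · ring_nf

theorem skew_of_slocal (h : SLocal 𝒱) (u v : V) : ∃ (r : ℕ) (t s : Fin r → V)
    (f : Fin r → ℤ → ℂ), (∀ i, IsLaurent (f i)) ∧ 𝒱.Y u v = 𝒱.skew (𝒱.oppSeries f t s) := by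
  obtain ⟨r, s, t, f, k, hf, hk⟩ := h u v
  refine ⟨r, t, s, f, hf, ?_⟩
  have hφ' := 𝒱.isLaurent_oppSeries t s hf
  have hloc := (𝒱.locality_iff_pair t s hf u v 𝒱.one k).1 (hk 𝒱.one)
  have hopp := 𝒱.three_oppPair t s hf 𝒱.one
  have hiter := 𝒱.three_iterPair (𝒱.trunc u v) 𝒱.one
  obtain ⟨c₀, hc₀⟩ := 𝒱.exists_iterPair_eq_zero (𝒱.trunc u v)
  obtain ⟨c₁, hc₁⟩ := 𝒱.exists_iterPair_eq_zero hφ'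
  have hsub := ((𝒱.three_prodPair u v 𝒱.one).sub hopp).vanish_of_le_c k
    fun a b => sub_eq_zero.2 (hloc a b)
  have J := (((𝒱.three_prodPair u v 𝒱.one).sub hopp).sub hiter).vanish_ac 0 (max k c₀)
    (fun a b c ha => by
      rw [𝒱.prodPair_vac u v a b c ha, 𝒱.oppPair_eq_zero t s
        (fun i c => 𝒱.prodPair_vac_eq_zero _ _ _ _ _ ha), sub_zero, sub_self])
    (fun a b c hc => by rw [hsub a b c (by omega), hc₀ _ _ _ _ (by omega), sub_zero])
  have D := (hiter.add (𝒱.three_iterPair hφ' 𝒱.one).reflect').vanish_bc 0 (max c₀ c₁)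
    (fun a b c hb => by
      have := J a b c
      rw [𝒱.prodPair_vac_eq_zero u v a b c hb, 𝒱.oppPair_eq_iterPair t s hf
        (fun i c => 𝒱.prodPair_vac _ _ _ _ _ hb)] at this
      rw [← neg_eq_zero, neg_add, add_comm, ← sub_eq_add_neg, ← zero_sub]
      exact this)
    (fun a b c hc => by
      rw [hc₀ _ _ _ _ (by omega), hc₁ _ _ _ _ (by omega), smul_zero, add_zero])
  funext n
  have e1 := D 0 (-1) (-n - 1)
  have e2 := 𝒱.iterPair_skew hφ' 𝒱.one (-1) (-n - 1)
  rw [← e2, add_left_inj, iterPair_zero, iterPair_zero] at e1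
  simpa [𝒱.creation_zero] using e1

theorem slocal_of_skew (h : ∀ u v : V, ∃ (r : ℕ) (t s : Fin r → V)
    (f : Fin r → ℤ → ℂ), (∀ i, IsLaurent (f i)) ∧ 𝒱.Y u v = 𝒱.skew (𝒱.oppSeries f t s)) :
    SLocal 𝒱 := by
  intro u v
  obtain ⟨r, t, s, f, hf, hY⟩ := h u v
  have hφ' := 𝒱.isLaurent_oppSeries t s hf
  obtain ⟨c₀, hc₀⟩ := 𝒱.exists_iterPair_eq_zero (𝒱.trunc u v)
  obtain ⟨c₁, hc₁⟩ := 𝒱.exists_iterPair_eq_zero hφ'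
  refine ⟨r, s, t, f, c₀.toNat, hf, fun w => (𝒱.locality_iff_pair t s hf u v w _).2 ?_⟩
  have hopp := 𝒱.three_oppPair t s hf w
  have hiter := 𝒱.three_iterPair (𝒱.trunc u v) w
  have hD := hiter.add (𝒱.three_iterPair hφ' w).reflect'
  have D := hD.vanish_ac 0 (max c₀ c₁)
    (hD.vanish_of_le_a 0 fun b c => by
      have := 𝒱.iterPair_skew hφ' w b c
      rwa [← hY] at this)
    (fun a b c hc => by
      rw [hc₀ _ _ _ _ (by omega), hc₁ _ _ _ _ (by omega), smul_zero, add_zero])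
  obtain ⟨l, hl⟩ := 𝒱.exists_prodPair_eq_iterPair u v w
  obtain ⟨b₀, hb₀⟩ := 𝒱.exists_prodPair_eq_zero u v w
  obtain ⟨a₀, ha₀⟩ := 𝒱.exists_oppPair_eq_zero (f := f) t s w
  obtain ⟨l', hl'⟩ := 𝒱.exists_oppPair_eq_iterPair t s hf w
  have J := (((𝒱.three_prodPair u v w).sub hopp).sub hiter).vanish_ab (max l a₀) (max b₀ l')
    (fun a b c ha => by
      rw [hl a b c (by omega), ha₀ a b c (by omega), sub_zero, sub_self])
    (fun a b c hb => by
      rw [hb₀ a b c (by omega), hl' a b c (by omega), zero_sub, ← neg_add', neg_eq_zero, add_comm]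
      exact D a b c)
  intro a b
  have := J a b c₀.toNat
  rwa [hc₀ _ _ _ _ (by omega), sub_zero, sub_eq_zero] at this

/-- The span of the series `f(x) Y(t,x)s`. -/
def series : Submodule ℂ (ℤ → V) := Submodule.span ℂ
  {φ | ∃ (f : ℤ → ℂ) (t s : V), IsLaurent f ∧ φ = conv (LinearMap.lsmul ℂ V) f (𝒱.Y t s)}

theorem series_induction {p : (ℤ → V) → Prop}
    (gen : ∀ (f : ℤ → ℂ) (t s : V), IsLaurent f → p (conv (LinearMap.lsmul ℂ V) f (𝒱.Y t s)))
    (zero : p 0) (add : ∀ φ ψ, IsLaurent φ → IsLaurent ψ → p φ → p ψ → p (φ + ψ))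
    {φ : ℤ → V} (hφ : φ ∈ 𝒱.series) : p φ := by
  suffices h : IsLaurent φ ∧ p φ from h.2
  induction hφ using Submodule.closure_induction with
  | zero => exact ⟨isLaurent_zero, zero⟩
  | add φ ψ _ _ h1 h2 => exact ⟨h1.1.add h2.1, add _ _ h1.1 h2.1 h1.2 h2.2⟩
  | smul_mem c φ hφ =>
    obtain ⟨f, t, s, hf, rfl⟩ := hφ
    rw [← conv_smul_left]
    exact ⟨(hf.smul c).conv _ (𝒱.trunc t s), gen _ t s (hf.smul c)⟩

theorem isLaurent_of_mem_series {φ : ℤ → V} (hφ : φ ∈ 𝒱.series) : IsLaurent φ :=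
  𝒱.series_induction (fun _ t s hf => hf.conv _ (𝒱.trunc t s)) isLaurent_zero
    (fun _ _ h1 h2 _ _ => h1.add h2) hφ

theorem conv_Y_mem_series {f : ℤ → ℂ} (hf : IsLaurent f) (t s : V) :
    conv (LinearMap.lsmul ℂ V) f (𝒱.Y t s) ∈ 𝒱.series :=
  Submodule.subset_span ⟨f, t, s, hf, rfl⟩

theorem Y_mem_series (t s : V) : 𝒱.Y t s ∈ 𝒱.series := by
  have hf : IsLaurent fun n : ℤ => if n = 0 then (1 : ℂ) else 0 := ⟨0, fun n hn => if_neg hn.ne⟩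
  convert 𝒱.conv_Y_mem_series hf t s using 1
  funext n
  rw [conv, finsum_eq_single _ 0 fun c hc => by simp [hc]]
  simp

theorem conv_mem_series {f : ℤ → ℂ} (hf : IsLaurent f) {φ : ℤ → V} (hφ : φ ∈ 𝒱.series) :
    conv (LinearMap.lsmul ℂ V) f φ ∈ 𝒱.series := by
  refine 𝒱.series_induction (p := fun φ => conv (LinearMap.lsmul ℂ V) f φ ∈ 𝒱.series)
    (fun g t s hg => ?_) ?_ (fun φ ψ h1 h2 h3 h4 => ?_) hφ
  · rw [← conv_assoc (LinearMap.mul ℂ ℂ) (LinearMap.lsmul ℂ V) (LinearMap.lsmul ℂ V)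
      (LinearMap.lsmul ℂ V) mul_smul hf hg (𝒱.trunc t s)]
    exact 𝒱.conv_Y_mem_series (hf.conv _ hg) t s
  · rw [conv_zero_right]; exact zero_mem _
  · rw [conv_add_right _ hf h1 h2]; exact add_mem h3 h4

theorem oppSeries_mem_series {ι : Type*} [Fintype ι] (t s : ι → V) {f : ι → ℤ → ℂ}
    (hf : ∀ i, IsLaurent (f i)) : 𝒱.oppSeries f t s ∈ 𝒱.series :=
  sum_mem fun i _ => 𝒱.conv_Y_mem_series (hf i) _ _

theorem exists_oppSeries_of_mem_series {φ : ℤ → V} (hφ : φ ∈ 𝒱.series) :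
    ∃ (r : ℕ) (t s : Fin r → V) (f : Fin r → ℤ → ℂ), (∀ i, IsLaurent (f i)) ∧
      φ = 𝒱.oppSeries f t s := by
  refine 𝒱.series_induction (p := fun φ => ∃ (r : ℕ) (t s : Fin r → V) (f : Fin r → ℤ → ℂ),
    (∀ i, IsLaurent (f i)) ∧ φ = 𝒱.oppSeries f t s) (fun f t s hf => ?_) ?_ ?_ hφ
  · exact ⟨1, fun _ => t, fun _ => s, fun _ => f, fun _ => hf, by simp [oppSeries]⟩
  · exact ⟨0, Fin.elim0, Fin.elim0, Fin.elim0, fun i => i.elim0, by simp [oppSeries]⟩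
  · rintro _ _ - - ⟨r, t, s, f, hf, rfl⟩ ⟨r', t', s', f', hf', rfl⟩
    refine ⟨r + r', Fin.append t t', Fin.append s s', Fin.append f f', fun i => ?_, ?_⟩
    · refine Fin.addCases (fun i => ?_) (fun i => ?_) i
      · simpa using hf i
      · simpa using hf' i
    · simp [oppSeries, Fin.sum_univ_add]

theorem slocal_iff_skew : SLocal 𝒱 ↔ ∀ u v : V, ∃ φ ∈ 𝒱.series, 𝒱.Y u v = 𝒱.skew φ := by
  refine ⟨fun h u v => ?_, fun h => 𝒱.slocal_of_skew fun u v => ?_⟩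
  · obtain ⟨r, t, s, f, hf, e⟩ := 𝒱.skew_of_slocal h u v
    exact ⟨_, 𝒱.oppSeries_mem_series t s hf, e⟩
  · obtain ⟨φ, hφ, e⟩ := h u v
    obtain ⟨r, t, s, f, hf, rfl⟩ := 𝒱.exists_oppSeries_of_mem_series hφ
    exact ⟨r, t, s, f, hf, e⟩

end NLVA

/-! ### Series with coefficients in a finite-dimensional subspace -/

section TensorLaurent

variable {A B : Type*} [AddCommGroup A] [Module ℂ A] [AddCommGroup B] [Module ℂ B]

theorem IsTensorLaurent.exists_eq_sum {α : ℤ → A} (hα : IsTensorLaurent α) :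
    ∃ (r : ℕ) (t : Fin r → A) (g : Fin r → ℤ → ℂ), (∀ i, IsLaurent (g i)) ∧
      ∀ n, α n = ∑ i, g i n • t i := by
  obtain ⟨⟨N, hN⟩, F, hF, hα⟩ := hα
  have : Module.Finite ℂ F := Module.Finite.iff_fg.2 hF
  let b := Module.finBasis ℂ F
  refine ⟨_, fun i => (b i : A), fun i n => b.repr ⟨α n, hα n⟩ i, fun i => ⟨N, fun n hn => ?_⟩,
    fun n => ?_⟩
  · have : (⟨α n, hα n⟩ : F) = 0 := Subtype.ext (hN n hn)
    simp [this]
  · have := congrArg F.subtype (b.sum_repr ⟨α n, hα n⟩).symm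
    rw [map_sum] at this
    exact this

theorem finsum_apply_eq_sum_conv (X : A →ₗ[ℂ] (ℤ → B)) (hX : ∀ t, IsLaurent (X t)) {ι : Type*}
    [Fintype ι] {α : ℤ → A} {g : ι → ℤ → ℂ} {t : ι → A}
    (hg : ∀ i, IsLaurent (g i)) (hα : ∀ n, α n = ∑ i, g i n • t i) (n : ℤ) :
    (∑ᶠ c, X (α c) (n - c)) = (∑ i, conv (LinearMap.lsmul ℂ B) (g i) (X (t i))) n := by
  simp only [hα, map_sum, map_smul, Finset.sum_apply, Pi.smul_apply]
  exact finsum_sum_comm _ _ fun i _ =>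
    conv_hasFiniteSupport (LinearMap.lsmul ℂ B) (hg i) (hX (t i)) n

theorem apply_hasFiniteSupport (X : A →ₗ[ℂ] (ℤ → B)) (hX : ∀ t, IsLaurent (X t)) {α : ℤ → A}
    (hα : IsTensorLaurent α) (n : ℤ) :
    (fun c => X (α c) (n - c)).HasFiniteSupport := by
  obtain ⟨r, t, g, hg, h⟩ := hα.exists_eq_sum
  have : (fun c => X (α c) (n - c)) = ∑ i, fun c => g i c • X (t i) (n - c) := by
    funext c
    simp only [h, map_sum, map_smul, Finset.sum_apply, Pi.smul_apply]
  rw [this]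
  exact Finset.sum_induction _ Function.HasFiniteSupport (fun _ _ h1 h2 => h1.add h2)
    (by simp [Function.HasFiniteSupport])
    fun i _ => conv_hasFiniteSupport (LinearMap.lsmul ℂ B) (hg i) (hX (t i)) n

end TensorLaurent

theorem negArg_negArg {A : Type*} [AddCommGroup A] [Module ℂ A] (φ : ℤ → A) :
    negArg (negArg φ) = φ :=
  funext fun n => neg_one_zpow_smul_smul n (φ n)

theorem negArg_add {A : Type*} [AddCommGroup A] [Module ℂ A] (φ ψ : ℤ → A) :
    negArg (φ + ψ) = negArg φ + negArg ψ :=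
  funext fun _ => smul_add _ _ _

namespace NLVA

section Skew

variable {V : Type*} [AddCommGroup V] [Module ℂ V] (𝒱 : NLVA V)

theorem skew_add {φ ψ : ℤ → V} (hφ : IsLaurent φ) (hψ : IsLaurent ψ) :
    𝒱.skew (φ + ψ) = 𝒱.skew φ + 𝒱.skew ψ := by
  rw [skew, negArg_add, conv_add_right _ 𝒱.isLaurent_expD hφ.negArg hψ.negArg]
  rfl

theorem conv_skew {f : ℤ → ℂ} (hf : IsLaurent f) {φ : ℤ → V} (hφ : IsLaurent φ) :
    conv (LinearMap.lsmul ℂ V) f (𝒱.skew φ)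
      = 𝒱.skew (conv (LinearMap.lsmul ℂ V) (negArg f) φ) := by
  rw [skew, skew, ← conv_negArg, negArg_negArg]
  exact (conv_left_comm _ _ _ _ (fun a b c => by simp) hf hφ.negArg 𝒱.isLaurent_expD).symm

/-- The span of the series `e^{xD} f(x) Y(t,-x)s`. -/
def skewSeries : AddSubmonoid (ℤ → V) where
  carrier := {φ | ∃ ψ ∈ 𝒱.series, φ = 𝒱.skew ψ}
  zero_mem' := ⟨0, zero_mem _, by funext n; simp [skew_apply]⟩
  add_mem' := by
    rintro _ _ ⟨φ, hφ, rfl⟩ ⟨ψ, hψ, rfl⟩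
    exact ⟨φ + ψ, add_mem hφ hψ, (𝒱.skew_add (𝒱.isLaurent_of_mem_series hφ)
      (𝒱.isLaurent_of_mem_series hψ)).symm⟩

theorem conv_mem_skewSeries {f : ℤ → ℂ} (hf : IsLaurent f) {φ : ℤ → V} (hφ : φ ∈ 𝒱.skewSeries) :
    conv (LinearMap.lsmul ℂ V) f φ ∈ 𝒱.skewSeries := by
  obtain ⟨ψ, hψ, rfl⟩ := hφ
  exact ⟨_, 𝒱.conv_mem_series hf.negArg hψ, 𝒱.conv_skew hf (𝒱.isLaurent_of_mem_series hψ)⟩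

end Skew

/-! ### The twisted tensor product -/

variable {U V : Type*} [AddCommGroup U] [Module ℂ U] [AddCommGroup V] [Module ℂ V]
  (𝒰 : NLVA U) (𝒱 : NLVA V)

/-- The linear map `b ⊗ c ↦ Y(a,x)b ⊗ Y(c,x)d`. -/
def tensorSeries (a : U) (d : V) : U ⊗[ℂ] V →ₗ[ℂ] (ℤ → U ⊗[ℂ] V) :=
  TensorProduct.lift <| LinearMap.mk₂ ℂ
    (fun b c => conv (TensorProduct.mk ℂ U V) (𝒰.Y a b) (𝒱.Y c d))
    (fun b b' c => by rw [map_add, conv_add_left _ (𝒰.trunc a b) (𝒰.trunc a b') (𝒱.trunc c d)])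
    (fun z b c => by rw [map_smul, conv_smul_left])
    (fun b c c' => by
      rw [map_add, LinearMap.add_apply,
        conv_add_right _ (𝒰.trunc a b) (𝒱.trunc c d) (𝒱.trunc c' d)])
    (fun z b c => by rw [map_smul, LinearMap.smul_apply, conv_smul_right])

theorem tensorSeries_tmul (a : U) (d : V) (b : U) (c : V) :
    tensorSeries 𝒰 𝒱 a d (b ⊗ₜ c) = conv (TensorProduct.mk ℂ U V) (𝒰.Y a b) (𝒱.Y c d) := rfl

theorem isLaurent_tensorSeries (a : U) (d : V) (t : U ⊗[ℂ] V) :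
    IsLaurent (tensorSeries 𝒰 𝒱 a d t) := by
  induction t using TensorProduct.induction_on with
  | zero => rw [map_zero]; exact isLaurent_zero
  | tmul b c => exact (𝒰.trunc a b).conv _ (𝒱.trunc c d)
  | add t t' h h' => rw [map_add]; exact h.add h'

theorem finsum_map_eq_tensorSeries (a : U) (d : V) (t : U ⊗[ℂ] V) (n : ℤ) :
    (∑ᶠ p, TensorProduct.map (𝒰.Yc p a) ((𝒱.Yc (n - p)).flip d) t)
      = tensorSeries 𝒰 𝒱 a d t n := by
  suffices h : (fun p => TensorProduct.map (𝒰.Yc p a) ((𝒱.Yc (n - p)).flip d) t).HasFiniteSupport ∧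
      (∑ᶠ p, TensorProduct.map (𝒰.Yc p a) ((𝒱.Yc (n - p)).flip d) t)
        = tensorSeries 𝒰 𝒱 a d t n from h.2
  induction t using TensorProduct.induction_on with
  | zero => simp [Function.HasFiniteSupport]
  | tmul b c =>
    exact ⟨conv_hasFiniteSupport (TensorProduct.mk ℂ U V) (𝒰.trunc a b) (𝒱.trunc c d) n, rfl⟩
  | add t t' h h' =>
    simp only [map_add, Pi.add_apply]
    exact ⟨h.1.add h'.1, by rw [finsum_add_distrib h.1 h'.1, h.2, h'.2]⟩

theorem conv_skew_skew {𝒯 : NLVA (U ⊗[ℂ] V)}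
    (h𝒯 : 𝒯.expD = conv (TensorProduct.mapBilinear (RingHom.id ℂ) U V U V) 𝒰.expD 𝒱.expD)
    {φ : ℤ → U} {ψ : ℤ → V} (hφ : IsLaurent φ) (hψ : IsLaurent ψ) :
    conv (TensorProduct.mk ℂ U V) (𝒰.skew φ) (𝒱.skew ψ)
      = 𝒯.skew (conv (TensorProduct.mk ℂ U V) φ ψ) := by
  have hU := 𝒰.isLaurent_expD
  have hV := 𝒱.isLaurent_expD
  rw [skew, skew, skew, h𝒯, ← conv_negArg,
    conv_assoc LinearMap.id (TensorProduct.mk ℂ U V) (TensorProduct.mk ℂ U V)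
      (LinearMap.rTensorHom V) (fun a b c => by simp) hU hφ.negArg (hV.conv _ hψ.negArg),
    conv_left_comm LinearMap.id (TensorProduct.mk ℂ U V) (TensorProduct.mk ℂ U V)
      (LinearMap.lTensorHom U) (fun a b c => by simp) hV hψ.negArg hφ.negArg,
    conv_assoc _ LinearMap.id (LinearMap.lTensorHom U) (LinearMap.rTensorHom V)
      (fun a b c => ?_) hU hV (hφ.negArg.conv _ hψ.negArg)]
  induction c using TensorProduct.induction_on with
  | zero => simp
  | tmul b c => simp
  | add t t' h h' => rw [map_add, map_add, map_add, h, h']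

theorem lift_Y_mem_series (𝒯 : NLVA (U ⊗[ℂ] V)) (a : U) (d : V) (t : V ⊗[ℂ] U) :
    TensorProduct.lift ((𝒯.Y ∘ₗ TensorProduct.mk ℂ U V a).compl₂
      ((TensorProduct.mk ℂ U V).flip d)) t ∈ 𝒯.series := by
  induction t using TensorProduct.induction_on with
  | zero => rw [map_zero]; exact zero_mem _
  | tmul c b => exact 𝒯.Y_mem_series (a ⊗ₜ c) (b ⊗ₜ d)
  | add t t' h h' => rw [map_add]; exact add_mem h h'

end NLVA

section TwistedTensor

variable {U V : Type*} [AddCommGroup U] [Module ℂ U] [AddCommGroup V] [Module ℂ V]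
  {𝒰 : NLVA U} {𝒱 : NLVA V} {Rop : TwistingOp 𝒰 𝒱} {𝒯 : NLVA (U ⊗[ℂ] V)}

open NLVA

theorem isTensorLaurent_negArg {A : Type*} [AddCommGroup A] [Module ℂ A] {α : ℤ → A}
    (hα : IsTensorLaurent α) : IsTensorLaurent (negArg α) :=
  let ⟨h, F, hF, hF'⟩ := hα
  ⟨h.negArg, F, hF, fun n => F.smul_mem _ (hF' n)⟩

namespace IsTwistedTensor

theorem Y_tmul_tmul (h𝒯 : IsTwistedTensor 𝒰 𝒱 Rop 𝒯) (u u' : U) (v v' : V) (n : ℤ) :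
    𝒯.Y (u ⊗ₜ v) (u' ⊗ₜ v') n
      = ∑ᶠ c, tensorSeries 𝒰 𝒱 u v' (negArg (fun c => Rop.Rc c (v ⊗ₜ u')) c) (n - c) := by
  rw [h𝒯.2]
  refine finsum_congr fun c => ?_
  rw [← smul_finsum, finsum_map_eq_tensorSeries, negArg, map_smul, Pi.smul_apply]

theorem expD_eq (h𝒯 : IsTwistedTensor 𝒰 𝒱 Rop 𝒯) :
    𝒯.expD = conv (TensorProduct.mapBilinear (RingHom.id ℂ) U V U V) 𝒰.expD 𝒱.expD := by
  funext n
  refine TensorProduct.ext' fun u v => ?_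
  have e := ((LinearMap.applyₗ (R := ℂ) (u ⊗ₜ[ℂ] v)).toAddMonoidHom.map_finsum
    (conv_hasFiniteSupport (TensorProduct.mapBilinear (RingHom.id ℂ) U V U V)
      𝒰.isLaurent_expD 𝒱.isLaurent_expD n))
  refine Eq.trans ?_ e.symm
  rw [expD_apply, h𝒯.1, h𝒯.Y_tmul_tmul, finsum_eq_single _ 0]
  · simp only [negArg, Rop.vac_right, zpow_zero, one_smul, if_true, sub_zero]
    rfl
  · intro c hc
    simp [negArg, Rop.vac_right, hc]

/-- For `t = ∑ c ⊗ b`, the series `∑ Y(a ⊗ c, x)(b ⊗ d)` in terms of `R(-x)t`. -/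
theorem lift_Y_apply (h𝒯 : IsTwistedTensor 𝒰 𝒱 Rop 𝒯) (a : U) (d : V) (t : V ⊗[ℂ] U) (n : ℤ) :
    TensorProduct.lift ((𝒯.Y ∘ₗ TensorProduct.mk ℂ U V a).compl₂
      ((TensorProduct.mk ℂ U V).flip d)) t n
      = ∑ᶠ c, tensorSeries 𝒰 𝒱 a d (negArg (fun c => Rop.Rc c t) c) (n - c) := by
  induction t using TensorProduct.induction_on with
  | zero => simp [negArg]
  | tmul c b => exact h𝒯.Y_tmul_tmul a b c d n
  | add t t' h h' =>
    have fin := fun t => apply_hasFiniteSupport _ (isLaurent_tensorSeries 𝒰 𝒱 a d)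
      (isTensorLaurent_negArg (Rop.laurent t)) n
    rw [map_add, Pi.add_apply, h, h', ← finsum_add_distrib (fin t) (fin t')]
    simp [negArg]

theorem tensorSeries_mem_series (h𝒯 : IsTwistedTensor 𝒰 𝒱 Rop 𝒯)
    {Sc : ℤ → (U ⊗[ℂ] V →ₗ[ℂ] V ⊗[ℂ] U)}
    (hinv : IsInvPair Rop.Rc Sc) (a : U) (d : V) (t : U ⊗[ℂ] V) :
    tensorSeries 𝒰 𝒱 a d t ∈ 𝒯.series := by
  obtain ⟨r, s, h, hh, hS⟩ := (hinv.1 t).exists_eq_sum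
  choose l p g hg hR using fun k => (Rop.laurent (s k)).exists_eq_sum
  have hX := isLaurent_tensorSeries 𝒰 𝒱 a d
  have hLift : ∀ k, TensorProduct.lift ((𝒯.Y ∘ₗ TensorProduct.mk ℂ U V a).compl₂
      ((TensorProduct.mk ℂ U V).flip d)) (s k) = ∑ j, conv (LinearMap.lsmul ℂ (U ⊗[ℂ] V))
        (negArg (g k j)) (tensorSeries 𝒰 𝒱 a d (p k j)) := fun k => funext fun n => by
    rw [h𝒯.lift_Y_apply, finsum_apply_eq_sum_conv _ hX (fun j => (hg k j).negArg)]
    intro n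
    simp only [negArg, hR, Finset.smul_sum, smul_smul, smul_eq_mul]
  have hmem : ∑ k, conv (LinearMap.lsmul ℂ (U ⊗[ℂ] V)) (negArg (h k))
      (∑ j, conv (LinearMap.lsmul ℂ (U ⊗[ℂ] V)) (negArg (g k j))
        (tensorSeries 𝒰 𝒱 a d (p k j))) ∈ 𝒯.series :=
    sum_mem fun k _ => 𝒯.conv_mem_series (hh k).negArg (hLift k ▸ 𝒯.lift_Y_mem_series a d (s k))
  have hδ : ∀ n : ℤ, (if n = 0 then t else 0) = ∑ i : Σ k, Fin (l k),
      negArg (conv (LinearMap.mul ℂ ℂ) (h i.1) (g i.1 i.2)) n • p i.1 i.2 := fun n => by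
    have e1 : ∀ c, Rop.Rc c (Sc (n - c) t)
        = ∑ i : Σ k, Fin (l k), (h i.1 (n - c) * g i.1 i.2 c) • p i.1 i.2 := fun c => by
      rw [hS, map_sum, Fintype.sum_sigma]
      refine Finset.sum_congr rfl fun k _ => ?_
      rw [map_smul, hR, Finset.smul_sum]
      simp only [smul_smul]
    have e2 := hinv.2.2 t n
    simp only [e1] at e2
    have fin : ∀ i : Σ k, Fin (l k),
        (fun c => g i.1 i.2 c * h i.1 (n - c)).HasFiniteSupport := fun i =>
      conv_hasFiniteSupport (LinearMap.mul ℂ ℂ) (hg i.1 i.2) (hh i.1) n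
    rw [finsum_sum_comm] at e2
    · have e3 : (if n = 0 then t else 0) = (-1 : ℂ) ^ n • (if n = 0 then t else 0) := by
        split_ifs with hn
        · simp [hn]
        · simp
      rw [e3, ← e2, Finset.smul_sum]
      refine Finset.sum_congr rfl fun i _ => ?_
      rw [negArg, smul_assoc, ← finsum_smul]
      congr 2
      rw [← conv_flip]
      rfl
    · intro i _
      refine (fin i).subset fun c hc => ?_
      rw [Function.mem_support] at hc ⊢
      intro h0
      exact hc (by rw [mul_comm, h0, zero_smul])
  convert hmem using 1
  have e := fun n => finsum_apply_eq_sum_conv _ hX (fun i : Σ k, Fin (l k) =>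
    ((hh i.1).conv (LinearMap.mul ℂ ℂ) (hg i.1 i.2)).negArg) hδ n
  funext n
  have e' := e n
  rw [finsum_eq_single _ 0 (fun c hc => by rw [if_neg hc]; simp), if_pos rfl, sub_zero] at e'
  rw [e', Fintype.sum_sigma]
  refine congrFun (Finset.sum_congr rfl fun k _ => ?_) n
  rw [conv_sum_right _ _ (hh k).negArg fun j _ => (hg k j).negArg.conv _ (hX _)]
  refine Finset.sum_congr rfl fun j _ => ?_
  rw [← conv_negArg]
  exact conv_assoc _ _ _ _ mul_smul (hh k).negArg (hg k j).negArg (hX _)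

theorem conv_mk_mem_series (h𝒯 : IsTwistedTensor 𝒰 𝒱 Rop 𝒯)
    {Sc : ℤ → (U ⊗[ℂ] V →ₗ[ℂ] V ⊗[ℂ] U)}
    (hinv : IsInvPair Rop.Rc Sc) {φ : ℤ → U} {ψ : ℤ → V} (hφ : φ ∈ 𝒰.series)
    (hψ : ψ ∈ 𝒱.series) : conv (TensorProduct.mk ℂ U V) φ ψ ∈ 𝒯.series := by
  have hψ' := 𝒱.isLaurent_of_mem_series hψ
  refine 𝒰.series_induction (p := fun φ => conv (TensorProduct.mk ℂ U V) φ ψ ∈ 𝒯.series)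
    (fun f t s hf => ?_) ?_ (fun φ φ' h1 h2 h3 h4 => ?_) hφ
  · rw [conv_assoc _ _ (TensorProduct.mk ℂ U V) (LinearMap.lsmul ℂ (U ⊗[ℂ] V))
      (fun a b c => TensorProduct.smul_tmul' a b c) hf (𝒰.trunc t s) hψ']
    refine 𝒯.conv_mem_series hf ?_
    refine 𝒱.series_induction
      (p := fun ψ => conv (TensorProduct.mk ℂ U V) (𝒰.Y t s) ψ ∈ 𝒯.series)
      (fun g t' s' hg => ?_) ?_ (fun ψ ψ' h1 h2 h3 h4 => ?_) hψ
    · rw [conv_left_comm _ _ (TensorProduct.mk ℂ U V) (LinearMap.lsmul ℂ (U ⊗[ℂ] V))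
        (fun a b c => TensorProduct.tmul_smul a c b) hg (𝒱.trunc t' s') (𝒰.trunc t s)]
      exact 𝒯.conv_mem_series hg (h𝒯.tensorSeries_mem_series hinv t s' (s ⊗ₜ t'))
    · rw [conv_zero_right]; exact zero_mem _
    · rw [conv_add_right _ (𝒰.trunc t s) h1 h2]; exact add_mem h3 h4
  · rw [conv_zero_left]; exact zero_mem _
  · rw [conv_add_left _ h1 h2 hψ']; exact add_mem h3 h4

theorem tensorSeries_mem_skewSeries (h𝒯 : IsTwistedTensor 𝒰 𝒱 Rop 𝒯)
    {Sc : ℤ → (U ⊗[ℂ] V →ₗ[ℂ] V ⊗[ℂ] U)}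
    (hinv : IsInvPair Rop.Rc Sc) (hU : SLocal 𝒰) (hV : SLocal 𝒱) (a : U) (d : V)
    (t : U ⊗[ℂ] V) : tensorSeries 𝒰 𝒱 a d t ∈ 𝒯.skewSeries := by
  induction t using TensorProduct.induction_on with
  | zero => rw [map_zero]; exact zero_mem _
  | tmul b c =>
    obtain ⟨φ, hφ, e⟩ := 𝒰.slocal_iff_skew.1 hU a b
    obtain ⟨ψ, hψ, e'⟩ := 𝒱.slocal_iff_skew.1 hV c d
    refine ⟨_, h𝒯.conv_mk_mem_series hinv hφ hψ, ?_⟩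
    rw [tensorSeries_tmul, e, e', conv_skew_skew 𝒰 𝒱 h𝒯.expD_eq
      (𝒰.isLaurent_of_mem_series hφ) (𝒱.isLaurent_of_mem_series hψ)]
  | add t t' h h' => rw [map_add]; exact add_mem h h'

theorem Y_mem_skewSeries (h𝒯 : IsTwistedTensor 𝒰 𝒱 Rop 𝒯)
    {Sc : ℤ → (U ⊗[ℂ] V →ₗ[ℂ] V ⊗[ℂ] U)}
    (hinv : IsInvPair Rop.Rc Sc) (hU : SLocal 𝒰) (hV : SLocal 𝒱) (s t : U ⊗[ℂ] V) :
    𝒯.Y s t ∈ 𝒯.skewSeries := by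
  induction s using TensorProduct.induction_on with
  | zero => rw [map_zero]; exact zero_mem _
  | add s s' h h' => rw [map_add]; exact add_mem h h'
  | tmul u v =>
    induction t using TensorProduct.induction_on with
    | zero => rw [map_zero]; exact zero_mem _
    | add t t' h h' => rw [map_add]; exact add_mem h h'
    | tmul u' v' =>
      obtain ⟨r, p, g, hg, hp⟩ :=
        (isTensorLaurent_negArg (Rop.laurent (v ⊗ₜ u'))).exists_eq_sum
      have e : 𝒯.Y (u ⊗ₜ v) (u' ⊗ₜ v') = ∑ i, conv (LinearMap.lsmul ℂ (U ⊗[ℂ] V)) (g i)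
          (tensorSeries 𝒰 𝒱 u v' (p i)) := funext fun n => by
        rw [h𝒯.Y_tmul_tmul,
          finsum_apply_eq_sum_conv _ (isLaurent_tensorSeries 𝒰 𝒱 u v') hg hp]
      rw [e]
      exact sum_mem fun i _ => 𝒯.conv_mem_skewSeries (hg i)
        (h𝒯.tensorSeries_mem_skewSeries hinv hU hV u v' (p i))

end IsTwistedTensor

end TwistedTensor

/-- The twisted tensor product of weak quantum vertex algebras along
an invertible twisting operator is a weak quantum vertex algebra
(Proposition 3.9). -/
theorem statement_14 {U V : Type*} [AddCommGroup U] [Module ℂ U]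
    [AddCommGroup V] [Module ℂ V]
    (𝒰 : NLVA U) (𝒱 : NLVA V) (hU : SLocal 𝒰) (hV : SLocal 𝒱)
    (Rop : TwistingOp 𝒰 𝒱)
    (Sc : ℤ → (U ⊗[ℂ] V →ₗ[ℂ] V ⊗[ℂ] U)) (hinv : IsInvPair Rop.Rc Sc)
    (𝒯 : NLVA (U ⊗[ℂ] V)) (h𝒯 : IsTwistedTensor 𝒰 𝒱 Rop 𝒯) :
    SLocal 𝒯 := by
  exact 𝒯.slocal_iff_skew.2 fun s t => h𝒯.Y_mem_skewSeries hinv hU hV s t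
end
end

section
/- Let H be a nonlocal vertex bialgebra and let V be a nonlocal vertex H-module-algebra. Then for all h, h' ∈ H and v ∈ V: Y(h, z+x)Y(h', z)v = Y(Y(h,x)h', z)v, where both sides are well-defined elements of V((z))[[x]]. -/
open scoped TensorProduct BigOperators

noncomputable section

theorem zchoose_eq_ringChoose (n : ℤ) (k : ℕ) : zchoose n k = Ring.choose n k := by
  unfold zchoose
  split_ifs with h
  · lift n to ℕ using h
    rw [Int.toNat_natCast, Ring.choose_natCast]
  · obtain ⟨r, rfl⟩ : ∃ r : ℤ, n = -r := ⟨-n, by ring⟩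
    have hr : (r + k - 1 : ℤ) = (((k : ℤ) - -r - 1).toNat : ℤ) := by omega
    rw [Ring.choose_neg, hr, Ring.choose_natCast, Int.negOnePow_def]
    simp [Units.smul_def]

/-- The binomial coefficient `C(n, k)` for integers `n`, `k`, equal to zero for `k < 0`. -/
def intChoose (n k : ℤ) : ℤ := if 0 ≤ k then zchoose n k.toNat else 0

theorem intChoose_natCast (n : ℤ) (k : ℕ) : intChoose n k = zchoose n k := by
  simp [intChoose]

theorem intChoose_of_neg (n : ℤ) {k : ℤ} (hk : k < 0) : intChoose n k = 0 :=
  if_neg hk.not_ge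

theorem intChoose_succ (n k : ℤ) :
    intChoose (n + 1) k = intChoose n k + intChoose n (k - 1) := by
  rcases lt_trichotomy k 0 with hk | rfl | hk
  · simp [intChoose_of_neg _ hk, intChoose_of_neg _ (show k - 1 < 0 by omega)]
  · simp [intChoose, zchoose_eq_ringChoose]
  · obtain ⟨j, rfl⟩ : ∃ j : ℕ, k = (j + 1 : ℕ) := ⟨(k - 1).toNat, by omega⟩
    have hj : ((j + 1 : ℕ) : ℤ) - 1 = (j : ℕ) := by push_cast; ring
    rw [hj]
    simp only [intChoose_natCast, zchoose_eq_ringChoose, Ring.choose_succ_succ]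
    ring

theorem intChoose_symm {n : ℤ} (hn : 0 ≤ n) (k : ℤ) : intChoose n (n - k) = intChoose n k := by
  lift n to ℕ using hn
  rcases lt_or_ge k 0 with hk | hk
  · obtain ⟨j, hj⟩ : ∃ j : ℕ, (n : ℤ) - k = j := ⟨((n : ℤ) - k).toNat, by omega⟩
    rw [intChoose_of_neg _ hk, hj, intChoose_natCast, zchoose_eq_ringChoose, Ring.choose_natCast,
      Nat.choose_eq_zero_of_lt (by omega), Nat.cast_zero]
  · lift k to ℕ using hk
    rcases lt_or_ge n k with h | h
    · rw [intChoose_of_neg _ (by omega), intChoose_natCast, zchoose_eq_ringChoose,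
        Ring.choose_natCast, Nat.choose_eq_zero_of_lt h, Nat.cast_zero]
    · rw [← Nat.cast_sub h]
      simp only [intChoose_natCast, zchoose_eq_ringChoose, Ring.choose_natCast, Nat.choose_symm h]

section Substitution

variable {V : Type*} [AddCommGroup V] [Module ℂ V]

theorem substAdd02_eq_finsum (A : ℤ → ℤ → V) (a b : ℤ) :
    substAdd02 A a b = ∑ᶠ m : ℤ, (intChoose m (m - a) : ℂ) • A m (a + b - m) := by
  have hinj : Function.Injective fun i : ℕ => a + (i : ℤ) := fun i j h => by simpa using h
  have hsupp : (Function.support fun m : ℤ => (intChoose m (m - a) : ℂ) • A m (a + b - m)) ⊆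
      Set.range fun i : ℕ => a + (i : ℤ) := by
    intro m hm
    by_contra h
    refine hm ?_
    have : m - a < 0 := by
      by_contra! h'
      exact h ⟨(m - a).toNat, by dsimp only; omega⟩
    simp [intChoose_of_neg _ this]
  rw [← finsum_mem_univ, ← finsum_mem_inter_support, Set.univ_inter,
    ← Set.inter_eq_right.2 hsupp, finsum_mem_inter_support, finsum_mem_range hinj]
  refine finsum_congr fun i => ?_
  rw [show a + (i : ℤ) - a = i by ring, intChoose_natCast, show a + b - (a + (i : ℤ)) = b - i by ring]

theorem substAdd20_eq_finsum (A : ℤ → ℤ → V) (a b : ℤ) :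
    substAdd20 A a b = ∑ᶠ m : ℤ, (intChoose m a : ℂ) • A m (a + b - m) := by
  unfold substAdd20
  split_ifs with ha
  · refine finsum_congr fun m => ?_
    rw [intChoose, if_pos ha, show b - m + a = a + b - m by ring]
  · simp [intChoose_of_neg _ (not_le.1 ha)]

theorem substAdd02_eq_substAdd20 {A : ℤ → ℤ → V} (hA : ∀ m n, m < 0 → A m n = 0) :
    substAdd02 A = substAdd20 A := by
  ext a b
  rw [substAdd02_eq_finsum, substAdd20_eq_finsum]
  refine finsum_congr fun m => ?_
  rcases lt_or_ge m 0 with hm | hm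
  · simp [hA m _ hm]
  · rw [intChoose_symm hm]

/-- Multiplication of the double series `A(x₁,x₂)` by `x₁^i`. -/
def shiftFst (i : ℤ) : Module.End ℂ (ℤ → ℤ → V) where
  toFun A := fun a b => A (a - i) b
  map_add' _ _ := rfl
  map_smul' _ _ := rfl

/-- Multiplication of the double series `A(x₁,x₂)` by `x₂^j`. -/
def shiftSnd (j : ℤ) : Module.End ℂ (ℤ → ℤ → V) where
  toFun A := fun a b => A a (b - j)
  map_add' _ _ := rfl
  map_smul' _ _ := rfl

@[simp] theorem shiftFst_apply (i : ℤ) (A : ℤ → ℤ → V) (a b : ℤ) :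
    shiftFst i A a b = A (a - i) b := rfl

@[simp] theorem shiftSnd_apply (j : ℤ) (A : ℤ → ℤ → V) (a b : ℤ) :
    shiftSnd j A a b = A a (b - j) := rfl

theorem shiftFst_pow (k : ℕ) : (shiftFst 1 : Module.End ℂ (ℤ → ℤ → V)) ^ k = shiftFst k := by
  induction k with
  | zero => ext A a b; simp
  | succ k ih =>
    rw [pow_succ, ih]
    ext A a b
    simp only [Module.End.mul_apply, shiftFst_apply, Nat.cast_succ]
    congr 1; ring

theorem shiftSnd_pow (k : ℕ) : (shiftSnd 1 : Module.End ℂ (ℤ → ℤ → V)) ^ k = shiftSnd k := by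
  induction k with
  | zero => ext A a b; simp
  | succ k ih =>
    rw [pow_succ, ih]
    ext A a b
    simp only [Module.End.mul_apply, shiftSnd_apply, Nat.cast_succ]
    congr 1; ring

/-- Multiplication of a double series by `x₁ + x₂`. -/
def mulAdd : Module.End ℂ (ℤ → ℤ → V) := shiftSnd 1 + shiftFst 1

theorem mulAdd_apply (A : ℤ → ℤ → V) (a b : ℤ) :
    mulAdd A a b = A a (b - 1) + A (a - 1) b := rfl

theorem mulAddPow_eq_pow (k : ℕ) (A : ℤ → ℤ → V) : mulAddPow k A = (mulAdd ^ k) A := by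
  have hc : Commute (shiftSnd 1 : Module.End ℂ (ℤ → ℤ → V)) (shiftFst 1) := rfl
  ext a b
  rw [mulAdd, hc.add_pow]
  simp only [shiftFst_pow, shiftSnd_pow, LinearMap.sum_apply, Finset.sum_apply, mulAddPow]
  refine Finset.sum_congr rfl fun j hj => ?_
  have hj' : j ≤ k := by simpa [Nat.lt_succ_iff] using hj
  have hcast : ((k.choose j : ℕ) : Module.End ℂ (ℤ → ℤ → V)) A = ((k.choose j : ℕ) : ℂ) • A := by
    rw [Module.End.natCast_apply, Nat.cast_smul_eq_nsmul]
  rw [Module.End.mul_apply, hcast, map_smul, Module.End.mul_apply, Pi.smul_apply, Pi.smul_apply,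
    shiftSnd_apply, shiftFst_apply, Nat.cast_sub hj', sub_sub_eq_add_sub, add_sub_right_comm]

theorem mulAdd_finsum {w : ℤ → ℤ → ℂ} (hw : ∀ m a, w (m + 1) a = w m a + w m (a - 1))
    {A : ℤ → ℤ → V}
    (hA : ∀ a c, (Function.support fun m : ℤ => w m a • A m (c - m)).Finite) :
    mulAdd (fun a b => ∑ᶠ m : ℤ, w m a • A m (a + b - m))
      = fun a b => ∑ᶠ m : ℤ, w m a • shiftFst 1 A m (a + b - m) := by
  ext a b
  rw [mulAdd_apply, show a - 1 + b = a + (b - 1) by ring,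
    ← finsum_add_distrib (hA a _) (hA (a - 1) _),
    ← finsum_comp_equiv (Equiv.addRight (1 : ℤ))
      (f := fun m => w m a • shiftFst 1 A m (a + b - m))]
  refine finsum_congr fun m => ?_
  simp only [Equiv.coe_addRight]
  rw [hw, shiftFst_apply, add_sub_cancel_right, ← add_smul,
    show a + b - (m + 1) = a + (b - 1) - m by ring]

theorem mulAdd_substAdd02 {A : ℤ → ℤ → V} {N : ℤ} (hA : ∀ m n, n < N → A m n = 0) :
    mulAdd (substAdd02 A) = substAdd02 (shiftFst 1 A) := by
  have h := fun B : ℤ → ℤ → V => funext₂ (substAdd02_eq_finsum B)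
  rw [h, h]
  refine mulAdd_finsum (w := fun m a => (intChoose m (m - a) : ℂ)) (fun m a => ?_)
    fun a c => (Set.finite_Icc a (c - N)).subset fun m hm => ?_
  · rw [show m - (a - 1) = m + 1 - a by ring, intChoose_succ, Int.cast_add,
      show m + 1 - a - 1 = m - a by ring, add_comm]
  · refine ⟨?_, ?_⟩ <;> by_contra! h <;> refine hm ?_
    · simp [intChoose_of_neg m (show m - a < 0 by omega)]
    · simp [hA m (c - m) (by omega)]

theorem mulAdd_substAdd20 {A : ℤ → ℤ → V} (hA : IsLaurent2 A) :
    mulAdd (substAdd20 A) = substAdd20 (shiftFst 1 A) := by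
  obtain ⟨N, hN⟩ := hA
  have h := fun B : ℤ → ℤ → V => funext₂ (substAdd20_eq_finsum B)
  rw [h, h]
  refine mulAdd_finsum (w := fun m a => (intChoose m a : ℂ)) (fun m a => ?_)
    fun a c => (Set.finite_Icc N (c - N)).subset fun m hm => ?_
  · rw [intChoose_succ, Int.cast_add]
  · refine ⟨?_, ?_⟩ <;> by_contra! h <;> refine hm ?_
    · simp [hN m (c - m) (Or.inl h)]
    · simp [hN m (c - m) (Or.inr (by omega))]

theorem isLaurent2_shiftFst {A : ℤ → ℤ → V} (hA : IsLaurent2 A) {i : ℤ} (hi : 0 ≤ i) :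
    IsLaurent2 (shiftFst i A) := by
  obtain ⟨N, hN⟩ := hA
  exact ⟨N, fun m n h => hN _ _ (h.imp_left fun h => by omega)⟩

theorem IsLaurent2.mulAdd_pow_subst {A : ℤ → ℤ → V} (hA : IsLaurent2 A) (k : ℕ) :
    (mulAdd ^ k) (substAdd02 A) = substAdd02 (shiftFst k A) ∧
      (mulAdd ^ k) (substAdd20 A) = substAdd20 (shiftFst k A) := by
  induction k with
  | zero =>
    have : shiftFst ((0 : ℕ) : ℤ) A = A := by ext; simp
    rw [this]
    exact ⟨rfl, rfl⟩
  | succ k ih =>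
    have hk := isLaurent2_shiftFst hA (Nat.cast_nonneg k)
    have hs : shiftFst ((k + 1 : ℕ) : ℤ) A
        = shiftFst 1 (shiftFst (k : ℤ) A) := by
      rw [← shiftFst_pow, pow_succ', Module.End.mul_apply, shiftFst_pow]
    obtain ⟨N, hN⟩ := id hk
    rw [pow_succ', Module.End.mul_apply, Module.End.mul_apply, ih.1, ih.2, hs]
    exact ⟨mulAdd_substAdd02 fun m n h => hN m n (Or.inr h), mulAdd_substAdd20 hk⟩

/-- Both expansions of `A(x₀ + x₂, x₂)` agree after multiplication by a power of `x₀ + x₂`. -/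
theorem IsLaurent2.exists_mulAdd_pow_subst_eq {A : ℤ → ℤ → V} (hA : IsLaurent2 A) :
    ∃ k : ℕ, (mulAdd ^ k) (substAdd02 A) = (mulAdd ^ k) (substAdd20 A) := by
  obtain ⟨N, hN⟩ := id hA
  refine ⟨(-N).toNat, ?_⟩
  rw [(hA.mulAdd_pow_subst _).1, (hA.mulAdd_pow_subst _).2]
  exact substAdd02_eq_substAdd20 fun m n hm => hN _ _ (Or.inl (by omega))

theorem eq_zero_of_mulAdd_pow_eq_zero {A : ℤ → ℤ → V} {N : ℤ} (hA : ∀ a < N, A a = 0) {k : ℕ}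
    (h : (mulAdd ^ k) A = 0) : A = 0 := by
  induction k generalizing A with
  | zero => simpa using h
  | succ k ih =>
    have h' : mulAdd A = 0 := by
      refine ih (fun a ha => ?_) (by rwa [pow_succ, Module.End.mul_apply] at h)
      ext b
      simp [mulAdd_apply, hA a ha, hA (a - 1) (by omega)]
    have key : ∀ n : ℕ, ∀ a < N + n, A a = 0 := by
      intro n
      induction n with
      | zero => simpa using hA
      | succ n ihn =>
        intro a ha
        ext b
        have := congrFun (congrFun h' a) (b + 1)
        rw [mulAdd_apply, ihn (a - 1) (by push_cast at ha; omega)] at this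
        simpa using this
    ext a b
    rw [key (a - N + 1).toNat a (by omega), Pi.zero_apply, Pi.zero_apply, Pi.zero_apply]

end Substitution

/-- A finitely generated subspace admits a common truncation bound. -/
theorem exists_forall_mem_eq_zero {V W : Type*} [AddCommGroup V] [Module ℂ V] [AddCommGroup W]
    [Module ℂ W] (f : V →ₗ[ℂ] (ℤ → W)) (hf : ∀ v, IsLaurent (f v)) {F : Submodule ℂ V}
    (hF : F.FG) : ∃ N : ℤ, ∀ v ∈ F, ∀ n < N, f v n = 0 := by
  induction F, hF using Submodule.fg_induction with
  | singleton v =>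
    obtain ⟨N, hN⟩ := hf v
    refine ⟨N, fun u hu n hn => ?_⟩
    obtain ⟨c, rfl⟩ := Submodule.mem_span_singleton.1 hu
    simp [hN n hn]
  | sup F G _ _ hF hG =>
    obtain ⟨M, hM⟩ := hF
    obtain ⟨N, hN⟩ := hG
    refine ⟨min M N, fun u hu n hn => ?_⟩
    obtain ⟨x, hx, y, hy, rfl⟩ := Submodule.mem_sup.1 hu
    simp [hM x hx n (lt_of_lt_of_le hn (min_le_left _ _)),
      hN y hy n (lt_of_lt_of_le hn (min_le_right _ _))]

theorem NLVModAlg.isLaurent2_comp {H V : Type*} [AddCommGroup H] [Module ℂ H]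
    [AddCommGroup V] [Module ℂ V] {𝓗 : NLVBialg H} (MV : NLVModAlg 𝓗 V) (h h' : H) (v : V) :
    IsLaurent2 fun m n => MV.act.Yw h (MV.act.Yw h' v n) m := by
  obtain ⟨⟨N, hN⟩, F, hF, hmem⟩ := MV.scalar h' v
  obtain ⟨M, hM⟩ := exists_forall_mem_eq_zero (MV.act.Yw h) (MV.act.trunc h) hF
  refine ⟨min M N, fun m n hmn => ?_⟩
  rcases hmn with hm | hn
  · exact hM _ (hmem n) m (lt_of_lt_of_le hm (min_le_left _ _))
  · simp [hN n (lt_of_lt_of_le hn (min_le_right _ _))]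

/-- For a nonlocal vertex bialgebra `H` and a nonlocal vertex
`H`-module-algebra `V`, one has `Y(h,z+x)Y(h',z)v = Y(Y(h,x)h',z)v` (Lemma 4.2). -/
theorem statement_16 {H V : Type*} [AddCommGroup H] [Module ℂ H]
    [AddCommGroup V] [Module ℂ V]
    (𝓗 : NLVBialg H) (MV : NLVModAlg 𝓗 V) :
    ∀ (h h' : H) (v : V) (a b : ℤ),
      substAdd20 (fun m n => MV.act.Yw h (MV.act.Yw h' v n) m) a b
        = MV.act.Yw (𝓗.alg.Y h h' a) v b := by
  intro h h' v a b
  have hL := MV.isLaurent2_comp h h' v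
  set A : ℤ → ℤ → V := fun m n => MV.act.Yw h (MV.act.Yw h' v n) m
  set B : ℤ → ℤ → V := fun a b => MV.act.Yw (𝓗.alg.Y h h' a) v b with hB
  obtain ⟨k, hk⟩ := MV.act.weak_assoc h h' v
  obtain ⟨l, hl⟩ := hL.exists_mulAdd_pow_subst_eq
  obtain ⟨N, hN⟩ := 𝓗.alg.trunc h h'
  have hk' : (mulAdd ^ k) (substAdd02 A) = (mulAdd ^ k) B := by
    rw [← mulAddPow_eq_pow, ← mulAddPow_eq_pow]
    exact funext₂ hk
  have hAB : (mulAdd ^ (l + k)) (substAdd20 A - B) = 0 := by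
    rw [map_sub, sub_eq_zero]
    nth_rw 1 [add_comm]
    rw [pow_add, pow_add, Module.End.mul_apply, ← hl, Module.End.mul_apply, ← hk',
      ← Module.End.mul_apply, ← Module.End.mul_apply, ← pow_add, ← pow_add, add_comm]
  have hzero : substAdd20 A - B = 0 := by
    refine eq_zero_of_mulAdd_pow_eq_zero (N := min 0 N) (fun a ha => ?_) hAB
    ext b
    have h0 : ¬ 0 ≤ a := by omega
    simp [substAdd20, hB, h0, hN a (by omega)]
  exact congrFun (congrFun (sub_eq_zero.1 hzero) a) b
end
end
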